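/- arXiv:2303.10458 — 5 statements merged into one kernel-verified Lean document; each statement's English description precedes it below -/
import Mathlib

section
/- Let P ⊆ ℝⁿ be an alcoved polytope. Then its alcoved triangulation Δ (the triangulation of P induced by the affine hyperplane arrangement 𝒜_n) is a regular triangulation: there is a height function on the vertices of Δ such that lifting the vertices to ℝ^{n+1} by these heights, taking the convex hull, and projecting the lower faces back to ℝⁿ recovers exactly the simplices of Δ. -/
/-!
Statement 0: The alcoved triangulation of an alcoved polytope `P ⊆ ℝⁿ` (the triangulation
induced by the affine hyperplane arrangement `𝒜_n` of all hyperplanes `x_i - x_j = l`,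
with `x_0 = 0`) is a regular triangulation: there is a height function `w` on the vertices
of the triangulation such that each simplex of the triangulation is precisely the set of
vertices where some affine-linear function touches `w` from below.
-/

/-- Extend `x : Fin n → ℝ` by a zeroth coordinate equal to `0`. -/
def extCoord {n : ℕ} (x : Fin n → ℝ) : Fin (n + 1) → ℝ :=
  Fin.cons 0 x

/-- The hyperplane `x_i - x_j = l` of the affine arrangement `𝒜_n` (with the
convention `x_0 = 0`). -/
def alcHyperplane (n : ℕ) (i j : Fin (n + 1)) (l : ℤ) : Set (Fin n → ℝ) :=
  {x | extCoord x i - extCoord x j = (l : ℝ)}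

/-- A subset of `ℝⁿ` is a hyperplane of the arrangement `𝒜_n`. -/
def InArrangement (n : ℕ) (H : Set (Fin n → ℝ)) : Prop :=
  ∃ (i j : Fin (n + 1)) (l : ℤ), i ≠ j ∧ H = alcHyperplane n i j l

/-- An alcoved polytope: a compact full-dimensional subset of `ℝⁿ` cut out by finitely
many half-spaces of the form `x_i - x_j ≤ l` (so that every facet-defining hyperplane
belongs to the arrangement `𝒜_n`). -/
def IsAlcovedPolytope {n : ℕ} (P : Set (Fin n → ℝ)) : Prop :=
  IsCompact P ∧ (interior P).Nonempty ∧
    ∃ S : Finset (Fin (n + 1) × Fin (n + 1) × ℤ),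
      P = {x | ∀ c ∈ S, extCoord x c.1 - extCoord x c.2.1 ≤ (c.2.2 : ℝ)}

/-- The closed alcove (cell of the arrangement `𝒜_n`) containing a generic point `x`. -/
def alcoveOf {n : ℕ} (x : Fin n → ℝ) : Set (Fin n → ℝ) :=
  {y | ∀ i j : Fin (n + 1),
      (⌊extCoord x i - extCoord x j⌋ : ℝ) ≤ extCoord y i - extCoord y j ∧
      extCoord y i - extCoord y j ≤ (⌈extCoord x i - extCoord x j⌉ : ℝ)}

/-- A subset of `ℝⁿ` is an alcove: the closure of a region of the arrangement `𝒜_n`. -/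
def IsAlcove {n : ℕ} (C : Set (Fin n → ℝ)) : Prop :=
  ∃ x : Fin n → ℝ,
    (∀ (i j : Fin (n + 1)) (l : ℤ), i ≠ j → extCoord x i - extCoord x j ≠ (l : ℝ)) ∧
    C = alcoveOf x

/-- The alcoved triangulation of an alcoved polytope `P`: the collection of alcoves
contained in `P`. -/
def alcovedTriangulation {n : ℕ} (P : Set (Fin n → ℝ)) : Set (Set (Fin n → ℝ)) :=
  {C | IsAlcove C ∧ C ⊆ P}

/-- The set of vertices of the alcoved triangulation of `P`. -/
def triVertices {n : ℕ} (P : Set (Fin n → ℝ)) : Set (Fin n → ℝ) :=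
  ⋃ C ∈ alcovedTriangulation P, Set.extremePoints ℝ C

@[simp]
lemma extCoord_zero {n : ℕ} (x : Fin n → ℝ) : extCoord x 0 = 0 := rfl

@[simp]
lemma extCoord_succ {n : ℕ} (x : Fin n → ℝ) (i : Fin n) : extCoord x i.succ = x i := rfl

/-- A point of an alcove can be moved a little in any direction `u` that only changes
coordinate differences which are not integers. -/
lemma eventually_add_smul_mem_alcoveOf {n : ℕ} (x v u : Fin n → ℝ) (hv : v ∈ alcoveOf x)
    (hu : ∀ i j, extCoord u i ≠ extCoord u j →
      ∀ l : ℤ, extCoord v i - extCoord v j ≠ (l : ℝ)) :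
    ∀ᶠ t : ℝ in nhds 0, v + t • u ∈ alcoveOf x := by
  have hE : ∀ (t : ℝ) (i : Fin (n + 1)),
      extCoord (v + t • u) i = extCoord v i + t * extCoord u i := by
    intro t i
    refine Fin.cases ?_ (fun i => ?_) i <;> simp
  simp only [alcoveOf, Set.mem_ofPred_eq, Filter.eventually_all]
  intro i j
  obtain ⟨h₁, h₂⟩ := hv i j
  by_cases h : extCoord u i = extCoord u j
  · refine Filter.Eventually.of_forall fun t => ?_
    rw [hE, hE, h, add_sub_add_right_eq_sub]
    exact ⟨h₁, h₂⟩
  · have h₁' := lt_of_le_of_ne h₁ (hu i j h _).symm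
    have h₂' := lt_of_le_of_ne h₂ (hu i j h _)
    have hc : Filter.Tendsto
        (fun t : ℝ => extCoord (v + t • u) i - extCoord (v + t • u) j) (nhds 0)
        (nhds (extCoord v i - extCoord v j)) := by
      simp only [hE]
      have : Continuous fun t : ℝ =>
          extCoord v i + t * extCoord u i - (extCoord v j + t * extCoord u j) := by
        fun_prop
      simpa using this.tendsto 0
    filter_upwards [hc.eventually_const_lt h₁', hc.eventually_lt_const h₂'] with t ht₁ ht₂
    exact ⟨ht₁.le, ht₂.le⟩

/-- The vertices of an alcove are lattice points. -/
lemma fract_eq_zero_of_mem_extremePoints_alcoveOf {n : ℕ} {x v : Fin n → ℝ}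
    (hv : v ∈ Set.extremePoints ℝ (alcoveOf x)) (k : Fin n) : Int.fract (v k) = 0 := by
  by_contra hk
  let u : Fin n → ℝ := fun i => if Int.fract (v i) = Int.fract (v k) then 1 else 0
  have hu : ∀ i, extCoord u i =
      if Int.fract (extCoord v i) = Int.fract (v k) then 1 else 0 := by
    intro i
    refine Fin.cases ?_ (fun i => ?_) i
    · simp [Ne.symm hk]
    · rfl
  have hne : ∀ i j, extCoord u i ≠ extCoord u j →
      ∀ l : ℤ, extCoord v i - extCoord v j ≠ (l : ℝ) := by
    intro i j hij l hl
    refine hij ?_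
    rw [hu, hu, Int.fract_eq_fract.2 ⟨l, hl⟩]
  have hev := eventually_add_smul_mem_alcoveOf x v u hv.1 hne
  have hneg : Filter.Tendsto (fun t : ℝ => -t) (nhds 0) (nhds 0) := by
    simpa using (continuous_neg (G := ℝ)).tendsto 0
  obtain ⟨t, ⟨h₁, h₂⟩, ht⟩ := (((hev.and (hneg.eventually hev)).filter_mono
    nhdsWithin_le_nhds).and (self_mem_nhdsWithin (s := Set.Ioi (0 : ℝ)))).exists
  have hseg : v ∈ openSegment ℝ (v + t • u) (v + -t • u) := by
    refine ⟨1 / 2, 1 / 2, by norm_num, by norm_num, by norm_num, ?_⟩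
    module
  have h := congrFun (hv.2 h₁ h₂ hseg) k
  simp only [Pi.add_apply, Pi.smul_apply, smul_eq_mul, u, if_true] at h
  have : (0 : ℝ) < t := ht
  linarith

lemma exists_int_extCoord_sub {n : ℕ} {P : Set (Fin n → ℝ)} {v : Fin n → ℝ}
    (hv : v ∈ triVertices P) (i j : Fin (n + 1)) :
    ∃ d : ℤ, extCoord v i - extCoord v j = d := by
  simp only [triVertices, Set.mem_iUnion] at hv
  obtain ⟨C, ⟨⟨x, -, rfl⟩, -⟩, hv⟩ := hv
  have hfloor : ∀ i, extCoord v i = (⌊extCoord v i⌋ : ℝ) := by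
    intro i
    refine Fin.cases (by simp) (fun k => ?_) i
    have h := fract_eq_zero_of_mem_extremePoints_alcoveOf hv k
    rw [Int.fract, sub_eq_zero] at h
    exact h
  exact ⟨⌊extCoord v i⌋ - ⌊extCoord v j⌋, by rw [Int.cast_sub, ← hfloor, ← hfloor]⟩

lemma Int.sub_floor_mul_sub_ceil_nonneg (r : ℝ) (d : ℤ) :
    (0 : ℝ) ≤ ((d : ℝ) - ⌊r⌋) * ((d : ℝ) - ⌈r⌉) := by
  have h := Int.ceil_le_floor_add_one r
  have h' := Int.floor_le_ceil r
  norm_cast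
  rcases le_or_gt d ⌊r⌋ with hd | hd
  · exact mul_nonneg_of_nonpos_of_nonpos (by lia) (by lia)
  · exact mul_nonneg (by lia) (by lia)

lemma Int.sub_floor_mul_sub_ceil_eq_zero_iff (r : ℝ) (d : ℤ) :
    ((d : ℝ) - ⌊r⌋) * ((d : ℝ) - ⌈r⌉) = 0 ↔ (⌊r⌋ : ℝ) ≤ d ∧ (d : ℝ) ≤ ⌈r⌉ := by
  have h : (⌊r⌋ : ℝ) ≤ ⌈r⌉ := Int.cast_le.2 (Int.floor_le_ceil r)
  constructor
  · intro h₀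
    rcases mul_eq_zero.1 h₀ with h₁ | h₁ <;> constructor <;> linarith
  · rintro ⟨h₁, h₂⟩
    exact le_antisymm (mul_nonpos_of_nonneg_of_nonpos (by linarith) (by linarith))
      (Int.sub_floor_mul_sub_ceil_nonneg r d)

lemma sum_mul_extCoord_sub {n : ℕ} (m : Fin (n + 1) → Fin (n + 1) → ℝ) (v : Fin n → ℝ) :
    ∑ i, ∑ j, m i j * (extCoord v i - extCoord v j) =
      ∑ i : Fin n, (∑ j, (m i.succ j - m j i.succ)) * v i := by
  have h : ∑ i, ∑ j, m i j * (extCoord v i - extCoord v j) =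
      ∑ i, (∑ j, (m i j - m j i)) * extCoord v i := by
    simp only [mul_sub, Finset.sum_sub_distrib, sub_mul, Finset.sum_mul]
    rw [Finset.sum_comm (f := fun i j => m i j * extCoord v j)]
  rw [h, Fin.sum_univ_succ]
  simp

/-- The alcoved triangulation of an alcoved polytope is regular:
there is a height function `w` on the vertex set such that for every cell `C` of the
triangulation there is an affine-linear function lying weakly below `w` on all vertices
and touching `w` exactly at the vertices belonging to `C`.  (This is the standard
criterion for `Δ` to be the projection of the lower faces of the convex hull of the
vertex set lifted by `w`.) -/
theorem alcovedTriangulation_regular {n : ℕ} (P : Set (Fin n → ℝ))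
    (hP : IsAlcovedPolytope P) :
    ∃ w : (Fin n → ℝ) → ℝ,
      ∀ C ∈ alcovedTriangulation P,
        ∃ (a : Fin n → ℝ) (b : ℝ),
          (∀ v ∈ triVertices P, (∑ i, a i * v i) + b ≤ w v) ∧
          (∀ v ∈ triVertices P, ((∑ i, a i * v i) + b = w v ↔ v ∈ C)) := by
  refine ⟨fun v => ∑ i, ∑ j, (extCoord v i - extCoord v j) ^ 2, ?_⟩
  rintro C ⟨⟨x, -, rfl⟩, -⟩
  let f : Fin (n + 1) → Fin (n + 1) → ℝ := fun i j => ⌊extCoord x i - extCoord x j⌋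
  let c : Fin (n + 1) → Fin (n + 1) → ℝ := fun i j => ⌈extCoord x i - extCoord x j⌉
  let g : (Fin n → ℝ) → Fin (n + 1) → Fin (n + 1) → ℝ := fun v i j =>
    (extCoord v i - extCoord v j - f i j) * (extCoord v i - extCoord v j - c i j)
  let m : Fin (n + 1) → Fin (n + 1) → ℝ := fun i j => f i j + c i j
  refine ⟨fun i => ∑ j, (m i.succ j - m j i.succ), -∑ i, ∑ j, f i j * c i j, ?_⟩
  have hgap : ∀ v : Fin n → ℝ, ∑ i, ∑ j, (extCoord v i - extCoord v j) ^ 2 =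
      (∑ i : Fin n, (∑ j, (m i.succ j - m j i.succ)) * v i) +
        (-∑ i, ∑ j, f i j * c i j) + ∑ i, ∑ j, g v i j := by
    intro v
    rw [← sum_mul_extCoord_sub, ← sub_eq_add_neg]
    simp only [← Finset.sum_add_distrib, ← Finset.sum_sub_distrib]
    refine Finset.sum_congr rfl fun i _ => Finset.sum_congr rfl fun j _ => ?_
    simp only [g, m]
    ring
  have hnonneg : ∀ v ∈ triVertices P, ∀ i j, 0 ≤ g v i j := by
    intro v hv i j
    obtain ⟨d, hd⟩ := exists_int_extCoord_sub hv i j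
    simp only [g, hd]
    exact Int.sub_floor_mul_sub_ceil_nonneg _ d
  refine ⟨fun v hv => ?_, fun v hv => ?_⟩
  · beta_reduce
    rw [hgap v]
    exact le_add_of_nonneg_right
      (Finset.sum_nonneg fun i _ => Finset.sum_nonneg fun j _ => hnonneg v hv i j)
  · beta_reduce
    rw [hgap v, left_eq_add, Finset.sum_eq_zero_iff_of_nonneg
      fun i _ => Finset.sum_nonneg fun j _ => hnonneg v hv i j]
    simp only [Finset.mem_univ, true_imp_iff, alcoveOf, Set.mem_ofPred_eq]
    refine forall_congr' fun i => ?_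
    rw [Finset.sum_eq_zero_iff_of_nonneg fun j _ => hnonneg v hv i j]
    simp only [Finset.mem_univ, true_imp_iff]
    refine forall_congr' fun j => ?_
    obtain ⟨d, hd⟩ := exists_int_extCoord_sub hv i j
    simp only [g, hd]
    exact Int.sub_floor_mul_sub_ceil_eq_zero_iff _ d
end

section
/- A uniform matroid U_{k,n} is Gorenstein if and only if it is of the form U_{m,2m} (i.e., n = 2k), U_{1,n}, or U_{n−1,n}. -/
/-!
Statement 8: A uniform matroid `U_{k,n}` is Gorenstein iff `n = 2k`, `k = 1`, or
`k = n - 1`.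
-/

open scoped Pointwise

/-- The 0/1 indicator vector of a subset of `[n]`. -/
def indVec {n : ℕ} (B : Finset (Fin n)) : Fin n → ℝ :=
  fun i => if i ∈ B then 1 else 0

/-- The matroid polytope of the uniform matroid `U_{k,n}` (the hypersimplex
`Δ_{k,n}`): the convex hull of the indicator vectors of all `k`-subsets of `[n]`. -/
def hypersimplex (k n : ℕ) : Set (Fin n → ℝ) :=
  convexHull ℝ {x | ∃ B : Finset (Fin n), B.card = k ∧ x = indVec B}

/-- The number of lattice (integer) points of a subset of `ℝⁿ`. -/
noncomputable def latticeCount {n : ℕ} (S : Set (Fin n → ℝ)) : ℕ :=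
  Set.ncard {x ∈ S | ∀ i, ∃ m : ℤ, x i = (m : ℝ)}

/-- A lattice polytope `P` is `δ`-Gorenstein (`δ P` is reflexive): via Ehrhart
reciprocity, the lattice points in the relative interior of `(δ + t) P` are counted by
the Ehrhart polynomial of `P` at `t`, for every `t ≥ 0`. -/
def IsGorensteinOfIndex {n : ℕ} (P : Set (Fin n → ℝ)) (δ : ℕ) : Prop :=
  ∀ t : ℕ, latticeCount (intrinsicInterior ℝ ((((δ + t : ℕ) : ℝ)) • P)) =
    latticeCount ((t : ℝ) • P)

/-- A lattice polytope is Gorenstein if it is `δ`-Gorenstein for some positive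
integer `δ`. -/
def IsGorenstein {n : ℕ} (P : Set (Fin n → ℝ)) : Prop :=
  ∃ δ : ℕ, 1 ≤ δ ∧ IsGorensteinOfIndex P δ

/-! ### The hypersimplex as a slice of the cube -/

/-- The part of the cube `[0, s]ⁿ` in the hyperplane where the coordinates sum to `k * s`. -/
def cubeSlice (k n : ℕ) (s : ℝ) : Set (Fin n → ℝ) :=
  {x | (∀ i, 0 ≤ x i ∧ x i ≤ s) ∧ ∑ i, x i = k * s}

lemma convex_cubeSlice (k n : ℕ) (s : ℝ) : Convex ℝ (cubeSlice k n s) := by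
  rintro x ⟨hx, hxs⟩ y ⟨hy, hys⟩ a b ha hb hab
  refine ⟨fun i => ⟨?_, ?_⟩, ?_⟩
  · have := mul_nonneg ha (hx i).1
    have := mul_nonneg hb (hy i).1
    simp only [Pi.add_apply, Pi.smul_apply, smul_eq_mul]
    linarith
  · have h₁ := mul_le_mul_of_nonneg_left (hx i).2 ha
    have h₂ := mul_le_mul_of_nonneg_left (hy i).2 hb
    simp only [Pi.add_apply, Pi.smul_apply, smul_eq_mul]
    calc a * x i + b * y i ≤ a * s + b * s := add_le_add h₁ h₂
      _ = s := by rw [← add_mul, hab, one_mul]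
  · simp only [Pi.add_apply, Pi.smul_apply, smul_eq_mul, Finset.sum_add_distrib,
      ← Finset.mul_sum, hxs, hys]
    rw [← add_mul, hab, one_mul]

lemma isCompact_cubeSlice (k n : ℕ) (s : ℝ) : IsCompact (cubeSlice k n s) := by
  have h : cubeSlice k n s =
      Set.Icc (0 : Fin n → ℝ) (fun _ => s) ∩ {x | ∑ i, x i = k * s} := by
    ext x
    simp [cubeSlice, Pi.le_def, forall_and]
  rw [h]
  exact isCompact_Icc.inter_right (isClosed_eq (by fun_prop) (by fun_prop))

lemma sum_add_single_sub_single {R : Type*} [AddCommGroup R] {n : ℕ} (x : Fin n → R)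
    (a b : Fin n) (r : R) :
    ∑ i, (x + Pi.single a r - Pi.single b r : Fin n → R) i = ∑ i, x i := by
  simp [Finset.sum_add_distrib, Finset.sum_sub_distrib]

lemma add_single_sub_single_mem_cubeSlice {k n : ℕ} {s r : ℝ} {x : Fin n → ℝ}
    (hx : x ∈ cubeSlice k n s) {a b : Fin n} (hab : a ≠ b)
    (ha : 0 ≤ x a + r ∧ x a + r ≤ s) (hb : 0 ≤ x b - r ∧ x b - r ≤ s) :
    x + Pi.single a r - Pi.single b r ∈ cubeSlice k n s := by
  refine ⟨fun i => ?_, by rw [sum_add_single_sub_single]; exact hx.2⟩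
  rcases eq_or_ne i a with rfl | hia
  · simpa [hab] using ha
  · rcases eq_or_ne i b with rfl | hib
    · simpa [hia] using hb
    · simpa [hia, hib] using hx.1 i

lemma exists_indVec_of_mem_extremePoints {k n : ℕ} {x : Fin n → ℝ}
    (hx : x ∈ (cubeSlice k n 1).extremePoints ℝ) :
    ∃ B : Finset (Fin n), B.card = k ∧ x = indVec B := by
  classical
  obtain ⟨hxQ, hext⟩ := mem_extremePoints.1 hx
  have key : ∀ a, x a = 0 ∨ x a = 1 := by
    by_contra! h
    obtain ⟨a, ha0, ha1⟩ := h
    by_cases hb : ∃ b, b ≠ a ∧ x b ≠ 0 ∧ x b ≠ 1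
    · obtain ⟨b, hba, hb0, hb1⟩ := hb
      have la := lt_of_le_of_ne (hxQ.1 a).1 ha0.symm
      have ua := lt_of_le_of_ne (hxQ.1 a).2 ha1
      have lb := lt_of_le_of_ne (hxQ.1 b).1 hb0.symm
      have ub := lt_of_le_of_ne (hxQ.1 b).2 hb1
      obtain ⟨r, hr0, hr⟩ : ∃ r : ℝ, 0 < r ∧ r ≤ x a ∧ r ≤ 1 - x a ∧ r ≤ x b ∧ r ≤ 1 - x b :=
        ⟨min (min (x a) (1 - x a)) (min (x b) (1 - x b)), by simp [la, ua, lb, ub], by simp⟩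
      obtain ⟨h₁, h₂, h₃, h₄⟩ := hr
      have m₁ := add_single_sub_single_mem_cubeSlice (r := r) hxQ hba.symm
        ⟨by linarith, by linarith⟩ ⟨by linarith, by linarith⟩
      have m₂ := add_single_sub_single_mem_cubeSlice (r := -r) hxQ hba.symm
        ⟨by linarith, by linarith⟩ ⟨by linarith, by linarith⟩
      have hmid : x ∈ openSegment ℝ (x + Pi.single a r - Pi.single b r)
          (x + Pi.single a (-r) - Pi.single b (-r)) := by
        refine ⟨1 / 2, 1 / 2, by norm_num, by norm_num, by norm_num, ?_⟩
        ext i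
        simp only [Pi.single_neg, Pi.add_apply, Pi.smul_apply, Pi.sub_apply, Pi.neg_apply,
          smul_eq_mul]
        ring
      have := congrFun (hext _ m₁ _ m₂ hmid).1 a
      simp [hba.symm] at this
      exact hr0.ne' this
    · push Not at hb
      have hsum := hxQ.2
      rw [← Finset.add_sum_erase _ _ (Finset.mem_univ a)] at hsum
      have hint : ∑ i ∈ Finset.univ.erase a, x i =
          ((∑ i ∈ Finset.univ.erase a, if x i = 0 then 0 else 1 : ℤ) : ℝ) := by
        push_cast
        refine Finset.sum_congr rfl fun i hi => ?_
        split_ifs with h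
        · exact h
        · exact hb i (Finset.ne_of_mem_erase hi) h
      rw [hint] at hsum
      generalize (∑ i ∈ Finset.univ.erase a, if x i = 0 then 0 else 1 : ℤ) = m at hsum
      have hxa : x a = ((k - m : ℤ) : ℝ) := by push_cast; linarith
      have h0 : (0 : ℝ) < ((k - m : ℤ) : ℝ) := hxa ▸ lt_of_le_of_ne (hxQ.1 a).1 ha0.symm
      have h1 : ((k - m : ℤ) : ℝ) < (1 : ℤ) := by
        rw [← hxa]; simpa using lt_of_le_of_ne (hxQ.1 a).2 ha1
      have h0' : (0 : ℤ) < k - m := by exact_mod_cast h0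
      have h1' : (k - m : ℤ) < 1 := by exact_mod_cast h1
      omega
  have hxB : x = indVec (Finset.univ.filter fun i => x i = 1) := by
    ext i
    rcases key i with h | h <;> simp [indVec, h]
  refine ⟨_, ?_, hxB⟩
  have hsum := hxQ.2
  rw [hxB] at hsum
  simp only [indVec, Finset.sum_ite_mem, Finset.univ_inter, Finset.sum_const, nsmul_eq_mul,
    mul_one] at hsum
  exact_mod_cast hsum

lemma hypersimplex_eq_cubeSlice (k n : ℕ) : hypersimplex k n = cubeSlice k n 1 := by
  have hfin : {x : Fin n → ℝ | ∃ B : Finset (Fin n), B.card = k ∧ x = indVec B}.Finite :=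
    (Set.finite_range (indVec (n := n))).subset fun x ⟨B, _, h⟩ => ⟨B, h.symm⟩
  apply Set.Subset.antisymm
  · refine convexHull_min ?_ (convex_cubeSlice k n 1)
    rintro _ ⟨B, hB, rfl⟩
    refine ⟨fun i => ?_, by simp [indVec, hB]⟩
    by_cases h : i ∈ B <;> simp [indVec, h]
  · rw [← closure_convexHull_extremePoints (isCompact_cubeSlice k n 1) (convex_cubeSlice k n 1)]
    exact closure_minimal
      (convexHull_mono fun x hx => exists_indVec_of_mem_extremePoints hx) (hfin.isClosed_convexHull (𝕜 := ℝ))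

lemma smul_hypersimplex {k n : ℕ} (hkn : k ≤ n) (t : ℕ) :
    (t : ℝ) • hypersimplex k n = cubeSlice k n t := by
  rcases t.eq_zero_or_pos with rfl | ht
  · have hne : (hypersimplex k n).Nonempty := by
      obtain ⟨B, -, hB⟩ := Finset.exists_subset_card_eq
        (s := (Finset.univ : Finset (Fin n))) (n := k) (by simpa using hkn)
      exact ⟨indVec B, subset_convexHull ℝ _ ⟨B, hB, rfl⟩⟩
    rw [Nat.cast_zero, Set.zero_smul_set hne]
    ext x
    constructor
    · rintro rfl
      simp [cubeSlice]
    · rintro ⟨h, -⟩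
      exact funext fun i => le_antisymm (h i).2 (h i).1
  · have ht' : (0 : ℝ) < t := by exact_mod_cast ht
    rw [hypersimplex_eq_cubeSlice]
    ext x
    rw [Set.mem_smul_set_iff_inv_smul_mem₀ ht'.ne']
    simp only [cubeSlice, Set.mem_ofPred_eq, Pi.smul_apply, smul_eq_mul, ← Finset.mul_sum]
    refine and_congr (forall_congr' fun i => and_congr ?_ ?_) ?_
    · exact mul_nonneg_iff_of_pos_left (inv_pos.2 ht')
    · rw [inv_mul_le_iff₀ ht', mul_one]
    · rw [inv_mul_eq_iff_eq_mul₀ ht'.ne', mul_one, mul_comm]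

/-! ### Relative interior -/

lemma exists_lineMap_mem_of_mem_intrinsicInterior {E : Type*} [NormedAddCommGroup E]
    [NormedSpace ℝ E] {S : Set E} {x c : E} (hx : x ∈ intrinsicInterior ℝ S) (hc : c ∈ S) :
    ∃ ε : ℝ, 0 < ε ∧ AffineMap.lineMap c x (1 + ε) ∈ S := by
  obtain ⟨y, hy, rfl⟩ := hx
  let f : ℝ → affineSpan ℝ S := fun ε =>
    ⟨AffineMap.lineMap c (y : E) (1 + ε),
      AffineMap.lineMap_mem _ (subset_affineSpan ℝ S hc) y.2⟩
  have hf : Continuous f := Continuous.subtype_mk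
    (AffineMap.lineMap_continuous.comp (continuous_const.add continuous_id)) _
  have hf0 : f 0 = y := by simp [f]
  have hU : f ⁻¹' interior ((↑) ⁻¹' S) ∈ nhds (0 : ℝ) :=
    (isOpen_interior.preimage hf).mem_nhds (by simpa [hf0] using hy)
  obtain ⟨r, hr, hball⟩ := Metric.mem_nhds_iff.1 hU
  refine ⟨r / 2, half_pos hr, ?_⟩
  have : f (r / 2) ∈ interior ((↑) ⁻¹' S) :=
    hball (by simp [abs_of_pos hr, hr])
  exact interior_subset (s := ((↑) ⁻¹' S : Set (affineSpan ℝ S))) this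

lemma sum_eq_of_mem_affineSpan_cubeSlice {k n : ℕ} {s : ℝ} {x : Fin n → ℝ}
    (hx : x ∈ affineSpan ℝ (cubeSlice k n s)) : ∑ i, x i = k * s := by
  refine affineSpan_induction hx (fun y hy => hy.2) ?_
  intro c u v w hu hv hw
  simp [Finset.sum_add_distrib, Finset.sum_sub_distrib, ← Finset.mul_sum, hu, hv, hw]

lemma mem_intrinsicInterior_cubeSlice {k n : ℕ} (hk : 1 ≤ k) (hkn : k < n) {s : ℝ} (hs : 0 < s)
    {x : Fin n → ℝ} :
    x ∈ intrinsicInterior ℝ (cubeSlice k n s) ↔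
      (∀ i, 0 < x i ∧ x i < s) ∧ ∑ i, x i = k * s := by
  constructor
  · intro hx
    refine ⟨fun i => ?_, (intrinsicInterior_subset hx).2⟩
    have hk' : (0 : ℝ) < k := by exact_mod_cast hk
    have hkn' : (k : ℝ) < n := by exact_mod_cast hkn
    have hn : (0 : ℝ) < n := hk'.trans hkn'
    have hc0 : 0 < k * s / n := by positivity
    have hcs : k * s / n < s := by
      rw [div_lt_iff₀ hn, mul_comm s]
      exact mul_lt_mul_of_pos_right hkn' hs
    obtain ⟨ε, hε, hmem⟩ := exists_lineMap_mem_of_mem_intrinsicInterior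
      (c := fun _ => k * s / n) hx
      ⟨fun _ => ⟨hc0.le, hcs.le⟩, by simp [mul_div_cancel₀ _ hn.ne']⟩
    have h := hmem.1 i
    simp only [AffineMap.lineMap_apply, vsub_eq_sub, vadd_eq_add, Pi.add_apply, Pi.smul_apply,
      Pi.sub_apply, smul_eq_mul] at h
    constructor
    · by_contra! hx0
      nlinarith [mul_pos hε hc0]
    · by_contra! hx1
      nlinarith [mul_pos hε (sub_pos.2 hcs)]
  · rintro ⟨hx, hsum⟩
    have hxS : x ∈ cubeSlice k n s := ⟨fun i => ⟨(hx i).1.le, (hx i).2.le⟩, hsum⟩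
    refine ⟨⟨x, subset_affineSpan ℝ _ hxS⟩, ?_, rfl⟩
    have hopen : IsOpen (Set.univ.pi fun _ : Fin n => Set.Ioo 0 s) :=
      isOpen_set_pi Set.finite_univ fun _ _ => isOpen_Ioo
    refine mem_interior.2 ⟨_, fun y hy => ?_, hopen.preimage continuous_subtype_val,
      fun i _ => hx i⟩
    exact ⟨fun i => ⟨(hy i trivial).1.le, (hy i trivial).2.le⟩,
      sum_eq_of_mem_affineSpan_cubeSlice y.2⟩

/-! ### Lattice points -/

/-- The lattice points of the `s`-th dilate of the hypersimplex. -/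
def latticeSlice (k n : ℕ) (s : ℤ) : Set (Fin n → ℤ) :=
  {z | (∀ i, 0 ≤ z i ∧ z i ≤ s) ∧ ∑ i, z i = k * s}

/-- The lattice points in the relative interior of the `s`-th dilate of the hypersimplex. -/
def interiorLatticeSlice (k n : ℕ) (s : ℤ) : Set (Fin n → ℤ) :=
  {z | (∀ i, 0 < z i ∧ z i < s) ∧ ∑ i, z i = k * s}

lemma latticeCount_eq_ncard {n : ℕ} {S : Set (Fin n → ℝ)} {Z : Set (Fin n → ℤ)}
    (h : ∀ z : Fin n → ℤ, (fun i => (z i : ℝ)) ∈ S ↔ z ∈ Z) : latticeCount S = Z.ncard := by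
  have hinj : Function.Injective fun (z : Fin n → ℤ) i => (z i : ℝ) := fun z w hzw =>
    funext fun i => Int.cast_injective (congrFun hzw i)
  rw [latticeCount, ← Set.ncard_image_of_injective Z hinj]
  congr 1
  ext x
  constructor
  · rintro ⟨hxS, hx⟩
    choose m hm using hx
    obtain rfl : x = fun i => (m i : ℝ) := funext hm
    exact ⟨m, (h m).1 hxS, rfl⟩
  · rintro ⟨z, hz, rfl⟩
    exact ⟨(h z).2 hz, fun i => ⟨z i, rfl⟩⟩

lemma latticeCount_smul_hypersimplex {k n : ℕ} (hkn : k ≤ n) (t : ℕ) :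
    latticeCount ((t : ℝ) • hypersimplex k n) = (latticeSlice k n t).ncard := by
  refine latticeCount_eq_ncard fun z => ?_
  rw [smul_hypersimplex hkn]
  simp only [cubeSlice, latticeSlice, Set.mem_ofPred_eq]
  norm_cast

lemma latticeCount_intrinsicInterior_smul_hypersimplex {k n : ℕ} (hk : 1 ≤ k) (hkn : k < n)
    {t : ℕ} (ht : 0 < t) :
    latticeCount (intrinsicInterior ℝ ((t : ℝ) • hypersimplex k n)) =
      (interiorLatticeSlice k n t).ncard := by
  refine latticeCount_eq_ncard fun z => ?_
  rw [smul_hypersimplex hkn.le, mem_intrinsicInterior_cubeSlice hk hkn (by exact_mod_cast ht)]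
  simp only [interiorLatticeSlice, Set.mem_ofPred_eq]
  norm_cast

lemma isGorenstein_hypersimplex_iff {k n : ℕ} (hk : 1 ≤ k) (hkn : k < n) :
    IsGorenstein (hypersimplex k n) ↔ ∃ δ : ℕ, 1 ≤ δ ∧ ∀ t : ℕ,
      (interiorLatticeSlice k n (δ + t)).ncard = (latticeSlice k n t).ncard := by
  refine exists_congr fun δ => and_congr_right fun hδ => forall_congr' fun t => ?_
  rw [latticeCount_intrinsicInterior_smul_hypersimplex hk hkn (by omega),
    latticeCount_smul_hypersimplex hkn.le, Nat.cast_add]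

lemma sum_const_sub {n : ℕ} (s : ℤ) (z : Fin n → ℤ) :
    ∑ i, (s - z i) = n * s - ∑ i, z i := by
  simp [Finset.sum_sub_distrib]

lemma ncard_latticeSlice_sub {k n : ℕ} (hkn : k ≤ n) (s : ℤ) :
    (latticeSlice (n - k) n s).ncard = (latticeSlice k n s).ncard := by
  have hinv : Function.Involutive fun (z : Fin n → ℤ) i => s - z i := fun z => by simp
  rw [← Set.ncard_image_of_injective (latticeSlice k n s) hinv.injective,
    Set.image_eq_preimage_of_inverse hinv.leftInverse hinv.rightInverse]
  congr 1
  ext z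
  simp only [latticeSlice, Set.mem_preimage, Set.mem_ofPred_eq, sum_const_sub, Nat.cast_sub hkn]
  refine and_congr (forall_congr' fun i => ?_) ?_
  · constructor <;> intro h <;> constructor <;> linarith [h.1, h.2]
  · constructor <;> intro h <;> linarith

lemma ncard_interiorLatticeSlice_sub {k n : ℕ} (hkn : k ≤ n) (s : ℤ) :
    (interiorLatticeSlice (n - k) n s).ncard = (interiorLatticeSlice k n s).ncard := by
  have hinv : Function.Involutive fun (z : Fin n → ℤ) i => s - z i := fun z => by simp
  rw [← Set.ncard_image_of_injective (interiorLatticeSlice k n s) hinv.injective,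
    Set.image_eq_preimage_of_inverse hinv.leftInverse hinv.rightInverse]
  congr 1
  ext z
  simp only [interiorLatticeSlice, Set.mem_preimage, Set.mem_ofPred_eq, sum_const_sub,
    Nat.cast_sub hkn]
  refine and_congr (forall_congr' fun i => ?_) ?_
  · constructor <;> intro h <;> constructor <;> linarith [h.1, h.2]
  · constructor <;> intro h <;> linarith

lemma isGorenstein_hypersimplex_sub {k n : ℕ} (hk : 1 ≤ k) (hkn : k < n) :
    IsGorenstein (hypersimplex (n - k) n) ↔ IsGorenstein (hypersimplex k n) := by
  rw [isGorenstein_hypersimplex_iff (by omega) (by omega), isGorenstein_hypersimplex_iff hk hkn]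
  simp only [ncard_interiorLatticeSlice_sub hkn.le, ncard_latticeSlice_sub hkn.le]

lemma finite_latticeSlice (k n : ℕ) (s : ℤ) : (latticeSlice k n s).Finite :=
  (Set.finite_Icc (0 : Fin n → ℤ) fun _ => s).subset fun _ hz =>
    ⟨fun i => (hz.1 i).1, fun i => (hz.1 i).2⟩

lemma finite_interiorLatticeSlice (k n : ℕ) (s : ℤ) : (interiorLatticeSlice k n s).Finite :=
  (finite_latticeSlice k n s).subset fun _ hz =>
    ⟨fun i => ⟨(hz.1 i).1.le, (hz.1 i).2.le⟩, hz.2⟩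

lemma ncard_latticeSlice_zero (k n : ℕ) : (latticeSlice k n 0).ncard = 1 := by
  rw [Set.ncard_eq_one]
  refine ⟨0, Set.eq_singleton_iff_unique_mem.2 ⟨by simp [latticeSlice], fun z hz => ?_⟩⟩
  exact funext fun i => le_antisymm (hz.1 i).2 (hz.1 i).1

lemma injective_add_one (n : ℕ) : Function.Injective fun z : Fin n → ℤ => z + 1 :=
  add_left_injective 1

lemma sum_add_one {n : ℕ} (z : Fin n → ℤ) : ∑ i, (z + 1) i = ∑ i, z i + n := by
  simp [Finset.sum_add_distrib]

lemma isGorenstein_hypersimplex_one {n : ℕ} (hn : 1 < n) :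
    IsGorenstein (hypersimplex 1 n) := by
  rw [isGorenstein_hypersimplex_iff le_rfl hn]
  refine ⟨n, hn.le, fun t => ?_⟩
  rw [← Set.ncard_image_of_injective (latticeSlice 1 n t) (injective_add_one n)]
  congr 1
  ext z
  constructor
  · rintro ⟨hz, hsum⟩
    have hsum' : ∑ i, (z - 1) i = t := by
      have := sum_add_one (z - 1)
      rw [sub_add_cancel] at this
      push_cast at hsum
      linarith
    have h0 : ∀ i, 0 ≤ (z - 1) i := fun i => by
      have := (hz i).1
      simp only [Pi.sub_apply, Pi.one_apply]
      omega
    refine ⟨z - 1, ⟨fun i => ⟨h0 i, ?_⟩, by simpa using hsum'⟩, by simp⟩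
    rw [← hsum']
    exact Finset.single_le_sum (fun j _ => h0 j) (Finset.mem_univ i)
  · rintro ⟨z, ⟨hz, hsum⟩, rfl⟩
    refine ⟨fun i => ?_, ?_⟩
    · have := hz i
      simp only [Pi.add_apply, Pi.one_apply]
      omega
    · rw [sum_add_one, hsum]
      push_cast
      ring

lemma isGorenstein_hypersimplex_two_mul {k : ℕ} (hk : 1 ≤ k) :
    IsGorenstein (hypersimplex k (2 * k)) := by
  rw [isGorenstein_hypersimplex_iff hk (by omega)]
  refine ⟨2, by norm_num, fun t => ?_⟩
  rw [← Set.ncard_image_of_injective (latticeSlice k (2 * k) t) (injective_add_one _)]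
  congr 1
  ext z
  constructor
  · rintro ⟨hz, hsum⟩
    refine ⟨z - 1, ⟨fun i => ?_, ?_⟩, by simp⟩
    · have := hz i
      simp only [Pi.sub_apply, Pi.one_apply]
      push_cast at this
      omega
    · have := sum_add_one (z - 1)
      rw [sub_add_cancel] at this
      push_cast at hsum this
      linarith
  · rintro ⟨z, ⟨hz, hsum⟩, rfl⟩
    refine ⟨fun i => ?_, ?_⟩
    · have := hz i
      simp only [Pi.add_apply, Pi.one_apply]
      push_cast
      omega
    · rw [sum_add_one, hsum]
      push_cast
      ring

/-- A unique interior lattice point of a dilate of the hypersimplex is constant, and the constant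
is as close as possible to one of the two bounds. -/
lemma eq_mul_or_of_ncard_interiorLatticeSlice_eq_one {k n : ℕ} (hn : 1 < n) {δ : ℕ}
    (h : (interiorLatticeSlice k n δ).ncard = 1) :
    (n : ℤ) = k * δ ∨ (n : ℤ) * (δ - 1) = k * δ := by
  obtain ⟨z, hz⟩ := Set.ncard_eq_one.1 h
  obtain ⟨hmem, huniq⟩ := Set.eq_singleton_iff_unique_mem.1 hz
  let a : Fin n := ⟨0, by omega⟩
  let b : Fin n := ⟨1, hn⟩
  have hab : a ≠ b := by simp [a, b]
  have hconst : ∀ i, z i = z a := fun i => by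
    have hswap : z ∘ Equiv.swap i a ∈ interiorLatticeSlice k n δ :=
      ⟨fun j => hmem.1 _, by
        rw [← hmem.2]; exact Equiv.sum_comp (Equiv.swap i a) z⟩
    simpa using (congrFun (huniq _ hswap) i).symm
  have hsum : (n : ℤ) * z a = k * δ := by
    rw [← hmem.2, Finset.sum_congr rfl fun i _ => hconst i]
    simp
  by_cases h1 : z a = 1
  · left; simpa [h1] using hsum
  by_cases h2 : z a = δ - 1
  · right; rw [← h2, hsum]
  exfalso
  have hza := hmem.1 a
  have hw : z + Pi.single a 1 - Pi.single b 1 ∈ interiorLatticeSlice k n δ := by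
    refine ⟨fun i => ?_, by rw [sum_add_single_sub_single]; exact hmem.2⟩
    have hi := hconst i
    rcases eq_or_ne i a with rfl | hia
    · simp [hab]
      omega
    · rcases eq_or_ne i b with rfl | hib
      · simp [hia]
        omega
      · simpa [hia, hib] using hmem.1 i
  have := congrFun (huniq _ hw) a
  simp [hab] at this

lemma ncard_latticeSlice_one_lt {k n δ : ℕ} (hk : 2 ≤ k) (hδ : 3 ≤ δ) (hn : n = k * δ) :
    (latticeSlice k n 1).ncard < (interiorLatticeSlice k n (δ + 1)).ncard := by
  have hkn : k < n := by nlinarith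
  have hn' : (n : ℤ) = k * δ := by exact_mod_cast hn
  rw [← Set.ncard_image_of_injective (latticeSlice k n 1) (injective_add_one n)]
  refine Set.ncard_lt_ncard ?_ (finite_interiorLatticeSlice k n _)
  rw [Set.ssubset_iff_of_subset]
  · let a : Fin n := ⟨0, by omega⟩
    let b : Fin n := ⟨1, by omega⟩
    have hab : a ≠ b := by simp [a, b]
    let w : Fin n → ℤ := fun i => if (i : ℕ) < k then 1 else 0
    have hwa : w a = 1 := by simp [w, a]; omega
    have hwb : w b = 1 := by simp [w, b]; omega
    have hw : ∀ i, 0 ≤ w i ∧ w i ≤ 1 := fun i => by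
      simp only [w]; split_ifs <;> simp
    have hsum : ∑ i, w i = k := by
      simp [w, Fin.card_filter_val_lt, hkn.le]
    refine ⟨w + Pi.single a 1 - Pi.single b 1 + 1, ⟨fun i => ?_, ?_⟩, ?_⟩
    · rcases eq_or_ne i a with rfl | hia
      · simp [hab, hwa]
        omega
      · rcases eq_or_ne i b with rfl | hib
        · simp [hia, hwb]
          omega
        · have := hw i
          simp [hia, hib]
          omega
    · rw [sum_add_one, sum_add_single_sub_single, hsum, hn']
      ring
    · rintro ⟨v, hv, hvw⟩
      have hva := congrFun hvw a
      have := (hv.1 a).2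
      simp [hab, hwa] at hva
      omega
  · rintro _ ⟨z, ⟨hz, hsum⟩, rfl⟩
    refine ⟨fun i => ?_, ?_⟩
    · have := hz i
      simp only [Pi.add_apply, Pi.one_apply]
      omega
    · rw [sum_add_one, hsum, hn']
      ring

lemma eq_two_mul_or_eq_one_of_ncard_eq {k n δ : ℕ} (hk : 1 ≤ k) (hkn : k < n)
    (hn : (n : ℤ) = k * δ)
    (h : (interiorLatticeSlice k n (δ + 1)).ncard = (latticeSlice k n 1).ncard) :
    n = 2 * k ∨ k = 1 := by
  have hn' : n = k * δ := by exact_mod_cast hn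
  by_contra! hne
  have hδ : 3 ≤ δ := by
    by_contra! hlt
    interval_cases δ <;> omega
  exact (ncard_latticeSlice_one_lt (by omega) hδ hn').ne' h

/-- The uniform matroid `U_{k,n}` is Gorenstein if and only if
`n = 2k`, `k = 1`, or `k = n - 1`. -/
theorem uniform_gorenstein_iff {n k : ℕ} (hk : 1 ≤ k) (hkn : k < n) :
    IsGorenstein (hypersimplex k n) ↔ (n = 2 * k ∨ k = 1 ∨ k = n - 1) := by
  constructor
  · rw [isGorenstein_hypersimplex_iff hk hkn]
    rintro ⟨δ, -, h⟩
    have h0 := h 0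
    have h1 := h 1
    simp only [Nat.cast_zero, add_zero, ncard_latticeSlice_zero] at h0
    rw [Nat.cast_one] at h1
    rcases eq_mul_or_of_ncard_interiorLatticeSlice_eq_one (by omega) h0 with hn | hn
    · have := eq_two_mul_or_eq_one_of_ncard_eq hk hkn hn h1
      tauto
    · rw [← ncard_interiorLatticeSlice_sub hkn.le, ← ncard_latticeSlice_sub hkn.le] at h1
      have := eq_two_mul_or_eq_one_of_ncard_eq (k := n - k) (by omega) (by omega)
        (by rw [Nat.cast_sub hkn.le]; linarith) h1
      omega
  · rintro (rfl | rfl | h)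
    · exact isGorenstein_hypersimplex_two_mul hk
    · exact isGorenstein_hypersimplex_one hkn
    · rw [← isGorenstein_hypersimplex_sub hk hkn, show n - k = 1 by omega]
      exact isGorenstein_hypersimplex_one (by omega)
end

section
/- For n ≥ 4 and 1 ≤ k ≤ n−2, the normalized volume of the matroid polytope of the rank-2 snake M_n[k,k] is σ_n(k,k) = C(n−1, k) − 1. -/
/-!
Statement 10: For `n ≥ 4` and `1 ≤ k ≤ n - 2`, the normalized volume of the matroid
polytope of the rank-2 snake `M_n[k,k]` is `σ_n(k,k) = C(n-1, k) - 1`.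
-/

open scoped Classical Pointwise

/-- The height of the lattice path associated to `A ⊆ [n]` after `i` steps:
the number of north steps (elements of `A`) among the first `i` steps. -/
def pathHeight {n : ℕ} (A : Finset (Fin n)) (i : ℕ) : ℕ :=
  (A.filter fun j => j.val < i).card

/-- Height after `i` steps of the upper path `U` of `M_n[k,ℓ]`, which has north steps
at positions `1` and `n - ℓ`. -/
def upperHt (n l i : ℕ) : ℕ :=
  (if 1 ≤ i then 1 else 0) + (if n - l ≤ i then 1 else 0)

/-- Height after `i` steps of the lower path `L` of `M_n[k,ℓ]`, which has its two
north steps at the end of the diagram (positions `n - k` and `n`). -/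
def lowerHt (n k i : ℕ) : ℕ :=
  (if n - k ≤ i then 1 else 0) + (if n ≤ i then 1 else 0)

/-- The bases of the rank-2 lattice path matroid `M_n[k,ℓ]`: all `2`-subsets of `[n]`
whose lattice path lies weakly between the lower and upper paths. -/
noncomputable def MklBases (n k l : ℕ) : Finset (Finset (Fin n)) :=
  Finset.univ.filter fun B => B.card = 2 ∧
    ∀ i ∈ Finset.range (n + 1),
      lowerHt n k i ≤ pathHeight B i ∧ pathHeight B i ≤ upperHt n l i

/-- The matroid polytope of `M_n[k,ℓ]`. -/
noncomputable def MklPolytope (n k l : ℕ) : Set (Fin n → ℝ) :=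
  convexHull ℝ {x | ∃ B ∈ MklBases n k l, x = indVec B}

/-- The normalized volume of a `d`-dimensional lattice polytope `P`: the `d`-th finite
difference at `0` of the Ehrhart counting function, i.e. `d! · vol(P)`. -/
noncomputable def normVol {n : ℕ} (P : Set (Fin n → ℝ)) (d : ℕ) : ℤ :=
  ∑ j ∈ Finset.range (d + 1),
    (-1 : ℤ) ^ j * (d.choose j : ℤ) * (latticeCount (((d - j : ℕ) : ℝ) • P) : ℤ)

/-- `σ_n(k,ℓ)`: the normalized volume of the rank-2 lattice path matroid polytope
`P_{M_n[k,ℓ]}`, set to `0` when the parameters are out of range. -/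
noncomputable def sigmaVol (n k l : ℕ) : ℤ :=
  if 1 ≤ k ∧ k ≤ l ∧ l ≤ n - 2 then normVol (MklPolytope n k l) (n - 1) else 0

/-- The number of functions `ι → ℕ` with total at most `t`. -/
lemma ncard_sum_le (ι : Type*) [Fintype ι] (t : ℕ) :
    {f : ι → ℕ | ∑ i, f i ≤ t}.ncard = (t + Fintype.card ι).choose (Fintype.card ι) := by
  have e : {f : ι → ℕ | ∑ i, f i ≤ t} ≃ {F : Option ι → ℕ // ∑ i, F i = t} :=
    { toFun := fun f => ⟨fun o => o.elim (t - ∑ i, f.1 i) f.1, by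
        have := f.2
        simp only [Set.mem_ofPred_eq] at this
        simp only [Fintype.sum_option, Option.elim_none, Option.elim_some]
        omega⟩
      invFun := fun F => ⟨fun i => F.1 (some i), by
        have := F.2
        rw [Fintype.sum_option] at this
        simp only [Set.mem_ofPred_eq]
        omega⟩
      left_inv := fun f => rfl
      right_inv := fun F => by
        have := F.2
        rw [Fintype.sum_option] at this
        ext o
        cases o with
        | none => simp only [Option.elim_none]; omega
        | some i => rfl }
  rw [← Nat.card_coe_set_eq, Nat.card_congr (e.trans (Sym.equivNatSumOfFintype (Option ι) t).symm),
    Nat.card_eq_fintype_card, Sym.card_sym_eq_choose, Fintype.card_option,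
    show Fintype.card ι + 1 + t - 1 = t + Fintype.card ι by omega, Nat.choose_symm_add]

lemma ncard_sum_lt (ι : Type*) [Fintype ι] [Nonempty ι] (t : ℕ) :
    {f : ι → ℕ | ∑ i, f i < t}.ncard = (t + Fintype.card ι - 1).choose (Fintype.card ι) := by
  have hι : 0 < Fintype.card ι := Fintype.card_pos
  cases t with
  | zero => simp [Nat.choose_eq_zero_of_lt (show Fintype.card ι - 1 < Fintype.card ι by omega)]
  | succ s =>
    simp only [Nat.lt_succ_iff]
    rw [ncard_sum_le, show s + 1 + Fintype.card ι - 1 = s + Fintype.card ι by omega]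

lemma finite_sum_le (ι : Type*) [Fintype ι] (t : ℕ) : {f : ι → ℕ | ∑ i, f i ≤ t}.Finite :=
  Set.finite_of_ncard_pos <| by
    rw [ncard_sum_le]
    exact Nat.choose_pos (by omega)

/-- The pairs of nonnegative integer vectors whose totals are at most `t` each, and at least `t`
together. -/
def boundedPairs (p k t : ℕ) : Set ((Fin p → ℕ) × (Fin k → ℕ)) :=
  {x | ∑ i, x.1 i ≤ t ∧ ∑ i, x.2 i ≤ t ∧ t ≤ ∑ i, x.1 i + ∑ i, x.2 i}

lemma ncard_boundedPairs (p k t : ℕ) (hk : 1 ≤ k) :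
    (boundedPairs p k t).ncard + (t + (p + k) - 1).choose (p + k) =
      (t + p).choose p * (t + k).choose k := by
  have : Nonempty (Fin p ⊕ Fin k) := ⟨Sum.inr ⟨0, hk⟩⟩
  set S : Set ((Fin p → ℕ) × (Fin k → ℕ)) :=
    {f | ∑ i, f i ≤ t} ×ˢ {g | ∑ i, g i ≤ t} with hS
  have hSfin : S.Finite := (finite_sum_le _ t).prod (finite_sum_le _ t)
  have hScard : S.ncard = (t + p).choose p * (t + k).choose k := by
    rw [hS, Set.ncard_prod, ncard_sum_le, ncard_sum_le, Fintype.card_fin, Fintype.card_fin]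
  set R : Set ((Fin p → ℕ) × (Fin k → ℕ)) :=
    Equiv.sumArrowEquivProdArrow _ _ _ '' {h : Fin p ⊕ Fin k → ℕ | ∑ i, h i < t} with hR
  have hmem : ∀ x, x ∈ R ↔ ∑ i, x.1 i + ∑ i, x.2 i < t := fun x => by
    rw [hR, Equiv.image_eq_preimage_symm]
    simp [Fintype.sum_sum_type, Equiv.sumArrowEquivProdArrow]
  have hRcard : R.ncard = (t + (p + k) - 1).choose (p + k) := by
    rw [hR, Set.ncard_image_of_injective _ (Equiv.injective _), ncard_sum_lt, Fintype.card_sum,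
      Fintype.card_fin, Fintype.card_fin]
  have hRS : R ⊆ S := fun x hx => by
    have := (hmem x).1 hx
    simp only [hS, Set.mem_prod, Set.mem_ofPred_eq]
    omega
  have hT : boundedPairs p k t = S \ R := by
    ext x
    simp only [boundedPairs, hS, Set.mem_sdiff, hmem, Set.mem_prod, Set.mem_ofPred_eq]
    omega
  rw [← hRcard, ← hScard, hT, Set.ncard_sdiff_add_ncard_of_subset hRS hSfin]

open Polynomial in
/-- The finite difference computing the normalized volume from the Ehrhart function. -/
lemma sum_alternating_eval (P : ℤ[X]) (d : ℕ) (hP : P.natDegree ≤ d) :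
    ∑ j ∈ Finset.range (d + 1), (-1 : ℤ) ^ j * (d.choose j : ℤ) * P.eval ((d - j : ℕ) : ℤ) =
      P.coeff d * d.factorial := by
  have h : (fwdDiff 1)^[d] P.eval 0 = P.coeff d * d.factorial := by
    rcases hP.lt_or_eq with h | h
    · rw [fwdDiff_iter_eq_zero_of_degree_lt h, coeff_eq_zero_of_natDegree_lt h]
      simp
    · subst h
      rw [fwdDiff_iter_degree_eq_factorial]
      simp
  rw [← h, fwdDiff_iter_eq_sum_shift, ← Finset.sum_range_reflect]
  refine Finset.sum_congr rfl fun j hj => ?_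
  have hj' : j ≤ d := by simpa [Nat.lt_succ_iff] using hj
  rw [show d + 1 - 1 - j = d - j by omega, Nat.choose_symm hj']
  simp [Nat.sub_sub_self hj']

open Polynomial in
lemma sum_alternating_choose (L : ℕ → ℕ) (p k : ℕ)
    (hL : ∀ t, L t + (t + (p + k) - 1).choose (p + k) = (t + p).choose p * (t + k).choose k) :
    ∑ j ∈ Finset.range (p + k + 1),
      (-1 : ℤ) ^ j * ((p + k).choose j : ℤ) * (L (p + k - j) : ℤ) = (p + k).choose k - 1 := by
  set d := p + k with hd
  let A : ℕ → ℤ[X] := fun m => (ascPochhammer ℤ m).comp (X + C 1)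
  have hAmonic : ∀ m, (A m).Monic := fun m => (monic_ascPochhammer ℤ m).comp_X_add_C 1
  have hAdeg : ∀ m, (A m).natDegree = m := fun m => by
    simp only [A, natDegree_comp, ascPochhammer_natDegree, natDegree_X_add_C, mul_one]
  have hAeval : ∀ m t : ℕ, (A m).eval (t : ℤ) = m.factorial * (t + m).choose m := fun m t => by
    have h := ascPochhammer_nat_eq_natCast_ascFactorial ℤ (t + 1) m
    rw [Nat.ascFactorial_eq_factorial_mul_choose] at h
    simp only [A, eval_comp, eval_add, eval_X, eval_C]
    exact_mod_cast h
  have hABmonic : (A p * A k).Monic := (hAmonic p).mul (hAmonic k)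
  have hABdeg : (A p * A k).natDegree = d := by
    rw [(hAmonic p).natDegree_mul (hAmonic k), hAdeg, hAdeg]
  let P : ℤ[X] := C (d.choose k : ℤ) * (A p * A k) - ascPochhammer ℤ d
  have hPdeg : P.natDegree ≤ d := by
    refine (natDegree_sub_le _ _).trans (max_le ?_ ?_)
    · exact (natDegree_C_mul_le _ _).trans hABdeg.le
    · exact (ascPochhammer_natDegree ℤ d).le
  have hPcoeff : P.coeff d = d.choose k - 1 := by
    have h1 : (A p * A k).coeff d = 1 := by rw [← hABdeg]; exact hABmonic
    have h2 : (ascPochhammer ℤ d).coeff d = 1 := by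
      have := monic_ascPochhammer ℤ d
      rwa [Monic, leadingCoeff, ascPochhammer_natDegree] at this
    simp only [P, coeff_sub, coeff_C_mul, h1, h2, mul_one]
  have hPeval : ∀ t : ℕ, P.eval (t : ℤ) = d.factorial * L t := fun t => by
    have h1 : ((d.choose k * p.factorial * k.factorial : ℕ) : ℤ) = d.factorial := by
      have := Nat.add_choose_mul_factorial_mul_factorial p k
      rw [← hd] at this
      rw [this]
    have h3 := ascPochhammer_nat_eq_natCast_ascFactorial ℤ t d
    rw [Nat.ascFactorial_eq_factorial_mul_choose'] at h3
    have h4 : (L t : ℤ) + (t + d - 1).choose d = (t + p).choose p * (t + k).choose k := by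
      exact_mod_cast hL t
    simp only [P, eval_sub, eval_mul, eval_C, hAeval, h3]
    push_cast at h1 ⊢
    linear_combination ((t + p).choose p * (t + k).choose k : ℤ) * h1 - (d.factorial : ℤ) * h4
  have h := sum_alternating_eval P d hPdeg
  have hd0 : (d.factorial : ℤ) ≠ 0 := by exact_mod_cast d.factorial_ne_zero
  simp only [hPeval, hPcoeff] at h
  refine mul_right_cancel₀ hd0 ?_
  rw [← h, Finset.sum_mul]
  exact Finset.sum_congr rfl fun j _ => by ring

/-- The vector with natural number entries `f`, then `w`, then `g`. -/
def blockVec {p k : ℕ} (f : Fin p → ℕ) (w : ℕ) (g : Fin k → ℕ) : Fin (p + 1 + k) → ℝ :=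
  fun i => (Fin.append (Fin.append f fun _ : Fin 1 => w) g i : ℕ)

section Blocks

variable {p k : ℕ}

lemma block_ext {α : Type*} {x y : Fin (p + 1 + k) → α}
    (hf : ∀ i : Fin p, x (Fin.castAdd k (Fin.castAdd 1 i)) = y (Fin.castAdd k (Fin.castAdd 1 i)))
    (hw : x (Fin.castAdd k (Fin.natAdd p 0)) = y (Fin.castAdd k (Fin.natAdd p 0)))
    (hg : ∀ i : Fin k, x (Fin.natAdd (p + 1) i) = y (Fin.natAdd (p + 1) i)) : x = y := by
  funext i
  refine Fin.addCases (fun i => ?_) hg i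
  refine Fin.addCases hf (fun i => ?_) i
  rwa [Subsingleton.elim i 0]

lemma mem_MklBases_pair {a b : Fin (p + 1 + k)} (hab : a < b) (ha : a.val ≤ p) (hb : p ≤ b.val) :
    {a, b} ∈ MklBases (p + 1 + k) k k := by
  have hab' : a.val < b.val := hab
  have hbn := b.isLt
  simp only [MklBases, Finset.mem_filter, Finset.mem_univ, true_and]
  refine ⟨Finset.card_pair hab.ne, fun i hi => ?_⟩
  have hh : pathHeight {a, b} i = (if a.val < i then 1 else 0) + (if b.val < i then 1 else 0) := by
    simp only [pathHeight, Finset.card_filter, Finset.sum_pair hab.ne]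
  have hi' := Finset.mem_range.1 hi
  rw [hh, lowerHt, upperHt]
  split_ifs <;> omega

/-- The `t`-th dilate of the polytope cut out by the parallel-class inequalities. -/
def blockPolytope (p k : ℕ) (t : ℝ) : Set (Fin (p + 1 + k) → ℝ) :=
  {x | (∀ i, 0 ≤ x i) ∧ ∑ i : Fin p, x (Fin.castAdd k (Fin.castAdd 1 i)) ≤ t ∧
    x (Fin.castAdd k (Fin.natAdd p 0)) ≤ t ∧ ∑ i : Fin k, x (Fin.natAdd (p + 1) i) ≤ t ∧
    ∑ i, x i = 2 * t}

lemma convex_blockPolytope (t : ℝ) : Convex ℝ (blockPolytope p k t) := by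
  rintro x ⟨hx0, hx1, hx2, hx3, hx4⟩ y ⟨hy0, hy1, hy2, hy3, hy4⟩ a b ha hb hab
  have ht : t = a * t + b * t := by rw [← add_mul, hab, one_mul]
  simp only [blockPolytope, Set.mem_ofPred_eq, Pi.add_apply, Pi.smul_apply, smul_eq_mul,
    Finset.sum_add_distrib, ← Finset.mul_sum]
  refine ⟨fun i => add_nonneg (mul_nonneg ha (hx0 i)) (mul_nonneg hb (hy0 i)), ?_, ?_, ?_, ?_⟩
  · rw [ht]; gcongr
  · rw [ht]; gcongr
  · rw [ht]; gcongr
  · rw [hx4, hy4]; linear_combination -2 * ht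

lemma indVec_mem_blockPolytope (hp : 1 ≤ p) {B : Finset (Fin (p + 1 + k))}
    (hB : B ∈ MklBases (p + 1 + k) k k) : indVec B ∈ blockPolytope p k 1 := by
  simp only [MklBases, Finset.mem_filter, Finset.mem_univ, true_and] at hB
  obtain ⟨hcard, hpath⟩ := hB
  have h1 := (hpath p (Finset.mem_range.2 (by omega))).2
  have h2 := (hpath (p + 1) (Finset.mem_range.2 (by omega))).1
  rw [upperHt, if_pos hp, if_neg (by omega)] at h1
  rw [lowerHt, if_pos (by omega)] at h2
  have hheight : ∀ i, pathHeight B i = ∑ j : Fin (p + 1 + k), if j ∈ B ∧ j.val < i then 1 else 0 :=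
    fun i => by
      rw [pathHeight, Finset.sum_boole, Nat.cast_id]
      congr 1
      ext j
      simp
  have hcard' : B.card = ∑ j, if j ∈ B then 1 else 0 := by simp
  rw [hheight] at h1 h2
  rw [hcard'] at hcard
  have hp' : ∀ i : Fin k, ¬ p + 1 + i.val < p := fun i => by omega
  simp only [Fin.sum_univ_add, Fin.val_castAdd, Fin.val_natAdd, Fin.is_lt, and_true,
    Fin.sum_univ_one, add_zero, and_false, if_false, hp', Finset.sum_const_zero,
    add_lt_iff_neg_left, not_lt_zero] at h1 h2 hcard
  have h3 : (∑ i : Fin k, if Fin.natAdd (p + 1) i ∈ B then 1 else 0) ≤ 1 := by omega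
  refine ⟨fun i => ?_, ?_, ?_, ?_, ?_⟩
  · rw [indVec]
    split_ifs <;> norm_num
  · simp only [indVec]
    exact_mod_cast h1
  · rw [indVec]
    split_ifs <;> norm_num
  · simp only [indVec]
    exact_mod_cast h3
  · simp only [indVec, Fin.sum_univ_add, Fin.sum_univ_one, mul_one]
    exact_mod_cast hcard

lemma smul_MklPolytope_subset (hp : 1 ≤ p) (t : ℕ) :
    (t : ℝ) • MklPolytope (p + 1 + k) k k ⊆ blockPolytope p k t := by
  rintro _ ⟨x, hx, rfl⟩
  have hsub : MklPolytope (p + 1 + k) k k ⊆ blockPolytope p k 1 := by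
    refine convexHull_min ?_ (convex_blockPolytope 1)
    rintro _ ⟨B, hB, rfl⟩
    exact indVec_mem_blockPolytope hp hB
  obtain ⟨h0, h1, h2, h3, h4⟩ := hsub hx
  have ht : (0 : ℝ) ≤ t := t.cast_nonneg
  simp only [blockPolytope, Set.mem_ofPred_eq, Pi.smul_apply, smul_eq_mul, ← Finset.mul_sum]
  refine ⟨fun i => mul_nonneg ht (h0 i), mul_le_of_le_one_right ht h1,
    mul_le_of_le_one_right ht h2, mul_le_of_le_one_right ht h3, ?_⟩
  rw [h4]
  ring

lemma exists_eq_add_single {ι : Type*} [Fintype ι] (f : ι → ℕ) (hf : 1 ≤ ∑ i, f i) :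
    ∃ (i : ι) (g : ι → ℕ), f = g + Pi.single i 1 ∧ ∑ i, f i = ∑ i, g i + 1 := by
  obtain ⟨i, hi⟩ : ∃ i, f i ≠ 0 := by
    by_contra! h
    simp [h] at hf
  have h : f = (f - Pi.single i 1) + Pi.single i 1 := by
    ext j
    by_cases hj : j = i
    · subst hj
      simp only [Pi.add_apply, Pi.sub_apply, Pi.single_eq_same]
      omega
    · simp [hj]
  refine ⟨i, _, h, ?_⟩
  conv_lhs => rw [h]
  simp [Finset.sum_add_distrib]

lemma blockVec_mem_smul (hk : 1 ≤ k) (t : ℕ) :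
    ∀ (f : Fin p → ℕ) (w : ℕ) (g : Fin k → ℕ), ∑ i, f i ≤ t → w ≤ t → ∑ i, g i ≤ t →
      ∑ i, f i + w + ∑ i, g i = 2 * t →
      blockVec f w g ∈ (t : ℝ) • MklPolytope (p + 1 + k) k k := by
  have hconv : Convex ℝ (MklPolytope (p + 1 + k) k k) := convex_convexHull ℝ _
  have hind : ∀ {a b : Fin (p + 1 + k)}, a < b → a.val ≤ p → p ≤ b.val →
      indVec {a, b} ∈ MklPolytope (p + 1 + k) k k := fun hab ha hb =>
    subset_convexHull ℝ _ ⟨_, mem_MklBases_pair hab ha hb, rfl⟩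
  induction t with
  | zero =>
    intro f w g hf hw hg hsum
    have hne : (MklPolytope (p + 1 + k) k k).Nonempty :=
      ⟨_, hind (a := Fin.castAdd k (Fin.natAdd p 0)) (b := Fin.natAdd (p + 1) ⟨0, hk⟩)
        (by simp [Fin.lt_def]) (by simp) (by simp)⟩
    have hf0 : f = 0 := by
      ext i; simpa using (Finset.sum_eq_zero_iff.1 (Nat.le_zero.1 hf)) i (Finset.mem_univ i)
    have hg0 : g = 0 := by
      ext i; simpa using (Finset.sum_eq_zero_iff.1 (Nat.le_zero.1 hg)) i (Finset.mem_univ i)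
    rw [Nat.cast_zero, Set.zero_smul_set hne, Set.mem_zero]
    obtain rfl : w = 0 := by omega
    subst hf0 hg0
    exact block_ext (by simp [blockVec]) (by simp [blockVec]) (by simp [blockVec])
  | succ t ih =>
    intro f w g hf hw hg hsum
    have step : ∀ {a b : Fin (p + 1 + k)} {y : Fin (p + 1 + k) → ℝ}, a < b → a.val ≤ p →
        p ≤ b.val → y ∈ (t : ℝ) • MklPolytope (p + 1 + k) k k →
        y + indVec {a, b} ∈ ((t + 1 : ℕ) : ℝ) • MklPolytope (p + 1 + k) k k := by
      intro a b y hab ha hb hy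
      rw [Nat.cast_succ, hconv.add_smul t.cast_nonneg zero_le_one, one_smul]
      exact Set.add_mem_add hy (hind hab ha hb)
    have hcases : (1 ≤ ∑ i, f i ∧ 1 ≤ w ∧ ∑ i, g i ≤ t) ∨
        (1 ≤ ∑ i, f i ∧ 1 ≤ ∑ i, g i ∧ w ≤ t) ∨ (1 ≤ w ∧ 1 ≤ ∑ i, g i ∧ ∑ i, f i ≤ t) := by
      omega
    rcases hcases with ⟨h1, h2, h3⟩ | ⟨h1, h2, h3⟩ | ⟨h1, h2, h3⟩
    · obtain ⟨i, f', rfl, hf'⟩ := exists_eq_add_single f h1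
      obtain ⟨w, rfl⟩ := Nat.exists_eq_add_of_le' h2
      have := step (a := Fin.castAdd k (Fin.castAdd 1 i)) (b := Fin.castAdd k (Fin.natAdd p 0))
        (by simp [Fin.lt_def]) (by simp) (by simp)
        (ih f' w g (by omega) (by omega) (by omega) (by omega))
      convert this using 1
      refine block_ext (fun j => ?_) ?_ fun j => ?_ <;>
        simp [blockVec, indVec, Pi.single_apply, Fin.ext_iff] <;> grind
    · obtain ⟨i, f', rfl, hf'⟩ := exists_eq_add_single f h1
      obtain ⟨j, g', rfl, hg'⟩ := exists_eq_add_single g h2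
      have := step (a := Fin.castAdd k (Fin.castAdd 1 i)) (b := Fin.natAdd (p + 1) j)
        (by simp [Fin.lt_def]; omega) (by simp) (by simp; omega)
        (ih f' w g' (by omega) (by omega) (by omega) (by omega))
      convert this using 1
      refine block_ext (fun j => ?_) ?_ fun j => ?_ <;>
        simp [blockVec, indVec, Pi.single_apply, Fin.ext_iff] <;> grind
    · obtain ⟨w, rfl⟩ := Nat.exists_eq_add_of_le' h1
      obtain ⟨j, g', rfl, hg'⟩ := exists_eq_add_single g h2
      have := step (a := Fin.castAdd k (Fin.natAdd p 0)) (b := Fin.natAdd (p + 1) j)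
        (by simp [Fin.lt_def]; omega) (by simp) (by simp; omega)
        (ih f w g' (by omega) (by omega) (by omega) (by omega))
      convert this using 1
      refine block_ext (fun j => ?_) ?_ fun j => ?_ <;>
        simp [blockVec, indVec, Pi.single_apply, Fin.ext_iff] <;> grind

lemma latticeCount_smul_MklPolytope (hp : 1 ≤ p) (hk : 1 ≤ k) (t : ℕ) :
    latticeCount ((t : ℝ) • MklPolytope (p + 1 + k) k k) = (boundedPairs p k t).ncard := by
  let Φ : (Fin p → ℕ) × (Fin k → ℕ) → Fin (p + 1 + k) → ℝ := fun x =>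
    blockVec x.1 (2 * t - ∑ i, x.1 i - ∑ i, x.2 i) x.2
  have hΦ : Function.Injective Φ := by
    rintro ⟨f, g⟩ ⟨f', g'⟩ h
    ext i
    · simpa [Φ, blockVec] using congrFun h (Fin.castAdd k (Fin.castAdd 1 i))
    · simpa [Φ, blockVec] using congrFun h (Fin.natAdd (p + 1) i)
  rw [latticeCount, ← Set.ncard_image_of_injective _ hΦ]
  congr 1
  ext x
  simp only [Set.mem_ofPred_eq, Set.mem_image, boundedPairs]
  constructor
  · rintro ⟨hx, hint⟩
    obtain ⟨h0, h1, h2, h3, h4⟩ := smul_MklPolytope_subset hp t hx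
    have hnat : ∀ i, ∃ m : ℕ, x i = m := fun i => by
      obtain ⟨m, hm⟩ := hint i
      have := h0 i
      rw [hm] at this
      lift m to ℕ using by exact_mod_cast this
      exact ⟨m, by simpa using hm⟩
    choose y hy using hnat
    obtain rfl : x = fun i => (y i : ℝ) := funext hy
    simp only [Fin.sum_univ_add, Fin.sum_univ_one] at h1 h2 h3 h4
    norm_cast at h1 h2 h3 h4
    refine ⟨(fun i => y (Fin.castAdd k (Fin.castAdd 1 i)), fun i => y (Fin.natAdd (p + 1) i)),
      ⟨h1, h3, ?_⟩, ?_⟩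
    · simp only
      omega
    · refine block_ext (fun i => ?_) ?_ fun i => ?_
      · simp [Φ, blockVec]
      · simp only [Φ, blockVec, Fin.append_left, Fin.append_right, Nat.cast_inj]
        omega
      · simp [Φ, blockVec]
  · rintro ⟨⟨f, g⟩, ⟨h1, h2, h3⟩, rfl⟩
    simp only at h1 h2 h3
    have hw : 2 * t - ∑ i, f i - ∑ i, g i ≤ t := by omega
    exact ⟨blockVec_mem_smul hk t f (2 * t - ∑ i, f i - ∑ i, g i) g h1 hw h2 (by omega),
      fun i => ⟨_, (Int.cast_natCast _).symm⟩⟩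

end Blocks

/-- `σ_n(k,k) = C(n-1,k) - 1` for `n ≥ 4` and `1 ≤ k ≤ n - 2`. -/
theorem sigma_snake (n k : ℕ) (hn : 4 ≤ n) (hk : 1 ≤ k) (hkn : k ≤ n - 2) :
    sigmaVol n k k = ((n - 1).choose k : ℤ) - 1 := by
  obtain ⟨p, hp, rfl⟩ : ∃ p, 1 ≤ p ∧ n = p + 1 + k := ⟨n - 1 - k, by omega, by omega⟩
  rw [sigmaVol, if_pos ⟨hk, le_rfl, hkn⟩, normVol, show p + 1 + k - 1 = p + k by omega]
  exact sum_alternating_choose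
    (fun t => latticeCount ((t : ℝ) • MklPolytope (p + 1 + k) k k)) p k fun t => by
      rw [latticeCount_smul_MklPolytope hp hk, ncard_boundedPairs p k t hk]
end

section
/- For n ≥ 4 and 1 ≤ k ≤ ℓ ≤ n−2 with ℓ ≥ 2, the normalized volumes of rank-2 lattice path matroid polytopes satisfy the recursion σ_n(k, ℓ−1) + σ_n(k, ℓ) + (C(n−1, k−1) + ℓ − k) = σ_{n+1}(k, ℓ), where σ_n(k,ℓ) is set to 0 whenever the parameters do not satisfy n ≥ 4 and 1 ≤ k ≤ ℓ ≤ n−2. -/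
/-!
Statement 11: The recursion
`σ_n(k, ℓ-1) + σ_n(k, ℓ) + (C(n-1, k-1) + ℓ - k) = σ_{n+1}(k, ℓ)`
for normalized volumes of rank-2 lattice path matroid polytopes.
-/

open scoped Classical Pointwise

/-- The number of `(x, y) ∈ ℕ^p × ℕ^q` with total sum `2t` such that the entries of `x` have
sum greater than `t`. -/
def excessCount (p q t : ℕ) : ℤ :=
  ∑ v ∈ Finset.range t, (p.multichoose (2 * t - v) : ℤ) * (q.multichoose v : ℤ)

lemma excessCount_zero_left (q : ℕ) : excessCount 0 q = 0 := by
  funext t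
  refine Finset.sum_eq_zero fun v hv => ?_
  obtain ⟨s, hs⟩ : ∃ s, 2 * t - v = s + 1 :=
    ⟨2 * t - v - 1, by have := Finset.mem_range.1 hv; omega⟩
  simp [hs]

lemma excessCount_one_right (p t : ℕ) :
    excessCount p 1 t = ((2 * t + p).choose p : ℤ) - ((t + p).choose p : ℤ) := by
  have key : ∀ m ≤ t, ∑ v ∈ Finset.range m, (p.multichoose (2 * t - v) : ℤ) =
      ((2 * t + p).choose p : ℤ) - ((2 * t - m + p).choose p : ℤ) := by
    intro m hm
    induction m with
    | zero => simp
    | succ m ih =>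
      rw [Finset.sum_range_succ, ih (by omega)]
      obtain ⟨s, hs⟩ : ∃ s, 2 * t - m = s + 1 := ⟨2 * t - m - 1, by omega⟩
      have hs' : 2 * t - (m + 1) = s := by omega
      rw [hs, hs', Nat.multichoose_eq]
      rcases p with _ | p
      · simp
      · have h1 : p + 1 + (s + 1) - 1 = s + 1 + p := by omega
        rw [h1, Nat.choose_symm_add (a := s + 1) (b := p),
          show s + 1 + (p + 1) = (s + 1 + p) + 1 by ring, Nat.choose_succ_succ,
          show s + (p + 1) = s + 1 + p by ring]
        push_cast
        ring
  have := key t le_rfl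
  simp only [excessCount, Nat.multichoose_one, Nat.cast_one, mul_one]
  rw [this, show 2 * t - t = t by omega]

lemma excessCount_succ_sub (p q t : ℕ) :
    excessCount (p + 1) (q + 1) (t + 1) - excessCount (p + 1) (q + 1) t =
      excessCount p (q + 1) (t + 1) + excessCount (p + 1) q (t + 1) -
        excessCount p q (t + 1) := by
  simp only [excessCount, Finset.sum_range_succ' _ t]
  have key : ∀ v ∈ Finset.range t,
      ((p + 1).multichoose (2 * (t + 1) - (v + 1)) : ℤ) * ((q + 1).multichoose (v + 1) : ℤ) =
        ((p + 1).multichoose (2 * t - v) : ℤ) * ((q + 1).multichoose v : ℤ) +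
        ((p.multichoose (2 * (t + 1) - (v + 1)) : ℤ) * ((q + 1).multichoose (v + 1) : ℤ) +
        ((p + 1).multichoose (2 * (t + 1) - (v + 1)) : ℤ) * (q.multichoose (v + 1) : ℤ) -
        (p.multichoose (2 * (t + 1) - (v + 1)) : ℤ) * (q.multichoose (v + 1) : ℤ)) := by
    intro v hv
    have hv := Finset.mem_range.1 hv
    rw [show 2 * (t + 1) - (v + 1) = (2 * t - v) + 1 by omega, Nat.multichoose_succ_succ p,
      Nat.multichoose_succ_succ q]
    push_cast
    ring
  rw [Finset.sum_congr rfl key]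
  simp only [Finset.sum_add_distrib, Finset.sum_sub_distrib, Nat.multichoose_zero_right]
  ring

lemma fwdDiff_iter_choose_two_mul (m b : ℕ) :
    (fwdDiff 1)^[m] (fun t : ℕ => ((2 * t + b).choose m : ℤ)) = fun _ => 2 ^ m := by
  induction m generalizing b with
  | zero => simp
  | succ m ih =>
    have h : fwdDiff 1 (fun t : ℕ => ((2 * t + b).choose (m + 1) : ℤ)) =
        (fun t : ℕ => ((2 * t + (b + 1)).choose m : ℤ)) +
          fun t : ℕ => ((2 * t + b).choose m : ℤ) := by
      funext t
      simp only [fwdDiff, Pi.add_apply]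
      rw [show 2 * (t + 1) + b = 2 * t + b + 1 + 1 by ring, Nat.choose_succ_succ,
        Nat.choose_succ_succ (2 * t + b), ← add_assoc (2 * t)]
      push_cast
      ring
    rw [Function.iterate_succ_apply, h, fwdDiff_iter_add, ih, ih]
    funext t
    simp only [Pi.add_apply]
    ring

lemma fwdDiff_iter_sub (f g : ℕ → ℤ) (n : ℕ) :
    (fwdDiff 1)^[n] (f - g) = (fwdDiff 1)^[n] f - (fwdDiff 1)^[n] g := by
  have h := fwdDiff_iter_add 1 (f - g) g n
  rw [sub_add_cancel] at h
  rw [h, add_sub_cancel_right]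

lemma fwdDiff_iter_excessCount (p q : ℕ) :
    (fwdDiff 1)^[p + q] (excessCount p (q + 1)) =
      fun _ => ∑ j ∈ Finset.range p, ((p + q).choose j : ℤ) := by
  induction q generalizing p with
  | zero =>
    have h : excessCount p (0 + 1) =
        (fun t : ℕ => ((2 * t + p).choose p : ℤ)) - fun t : ℕ => ((t + p).choose p : ℤ) := by
      funext t
      exact excessCount_one_right p t
    rw [h, add_zero, fwdDiff_iter_sub, fwdDiff_iter_choose_two_mul]
    funext t
    have h2 := fwdDiff_iter_comp_add 1 (fun x : ℕ => (x.choose p : ℤ)) p p t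
    have h3 := fwdDiff_iter_choose 0 p
    rw [add_zero] at h3
    rw [Pi.sub_apply, h2, h3]
    have h4 := Nat.sum_range_choose p
    rw [Finset.sum_range_succ] at h4
    simp only [Nat.choose_zero_right, Nat.cast_one]
    have h5 : ((∑ j ∈ Finset.range p, p.choose j + p.choose p : ℕ) : ℤ) = 2 ^ p := by
      rw [h4]; simp
    rw [Nat.choose_self] at h5
    push_cast at h5
    linarith
  | succ q ihq =>
    induction p with
    | zero =>
      rw [excessCount_zero_left]
      funext t
      simp [fwdDiff_iter_eq_sum_shift]
    | succ p ihp =>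
      have h : fwdDiff 1 (excessCount (p + 1) (q + 1 + 1)) =
          fun t => (excessCount p (q + 1 + 1) + excessCount (p + 1) (q + 1) -
            excessCount p (q + 1)) (t + 1) := by
        funext t
        exact excessCount_succ_sub p (q + 1) t
      have h1 : (fwdDiff 1)^[p + q + 1] (excessCount p (q + 1)) = fun _ => 0 := by
        rw [Function.iterate_succ_apply', ihq, fwdDiff_const]
      have h2 := ihq (p + 1)
      rw [show p + 1 + q = p + q + 1 by ring] at h2
      rw [← add_assoc] at ihp
      rw [show p + 1 + (q + 1) = (p + q + 1) + 1 by ring, Function.iterate_succ_apply, h]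
      funext t
      rw [fwdDiff_iter_comp_add, fwdDiff_iter_sub, fwdDiff_iter_add, ihp, h1, h2]
      simp only [Pi.sub_apply, Pi.add_apply, sub_zero]
      rw [Finset.sum_range_succ' _ p, Finset.sum_range_succ' _ p, ← add_assoc,
        ← Finset.sum_add_distrib]
      simp only [Nat.choose_zero_right, Nat.choose_succ_succ (p + q + 1)]
      push_cast
      rfl

lemma mem_piAntidiag_sum {n : ℕ} {S : Finset (Fin n)} {m : ℕ} {x : Fin n → ℕ} :
    x ∈ Finset.piAntidiag S m ↔ ∑ i ∈ S, x i = m ∧ ∀ i, x i ≠ 0 → i ∈ S :=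
  Finset.mem_piAntidiag

lemma card_piAntidiag_nat {n : ℕ} (S : Finset (Fin n)) (m : ℕ) :
    (Finset.piAntidiag S m).card = S.card.multichoose m := by
  rw [← Finset.card_finsuppAntidiag_nat_eq_multichoose]
  simp [Finset.finsuppAntidiag]

lemma card_filter_sum_eq {n : ℕ} (S : Finset (Fin n)) (u v : ℕ) :
    ((Finset.piAntidiag Finset.univ (u + v)).filter
      fun x : Fin n → ℕ => ∑ i ∈ Sᶜ, x i = v).card =
      S.card.multichoose u * Sᶜ.card.multichoose v := by
  rw [← card_piAntidiag_nat, ← card_piAntidiag_nat, ← Finset.card_product]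
  refine Finset.card_nbij' (fun x => (S.piecewise x 0, Sᶜ.piecewise x 0)) (fun y => y.1 + y.2)
    ?_ ?_ ?_ ?_
  · intro x hx
    simp only [Finset.coe_filter, mem_piAntidiag_sum, Set.mem_ofPred_eq] at hx
    obtain ⟨⟨h1, -⟩, h2⟩ := hx
    have h3 := Finset.sum_add_sum_compl S x
    simp only [Finset.coe_product, Set.mem_prod, Finset.mem_coe, mem_piAntidiag_sum]
    refine ⟨⟨?_, fun i hi => ?_⟩, ?_, fun i hi => ?_⟩
    · rw [Finset.sum_congr rfl fun i hi => S.piecewise_eq_of_mem x 0 hi]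
      omega
    · by_contra h
      simp [h] at hi
    · rw [Finset.sum_congr rfl fun i hi => Sᶜ.piecewise_eq_of_mem x 0 hi]
      exact h2
    · by_contra h
      exact hi (Finset.piecewise_eq_of_notMem _ _ _ h)
  · rintro ⟨y, z⟩ hyz
    simp only [Finset.coe_product, Set.mem_prod, Finset.mem_coe, mem_piAntidiag_sum] at hyz
    obtain ⟨⟨h1, h2⟩, h3, h4⟩ := hyz
    have h5 : ∑ i ∈ Sᶜ, y i = 0 := Finset.sum_eq_zero fun i hi => by
      by_contra h
      exact Finset.mem_compl.1 hi (h2 i h)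
    have h6 : ∑ i ∈ S, z i = 0 := Finset.sum_eq_zero fun i hi => by
      by_contra h
      exact Finset.mem_compl.1 (h4 i h) hi
    simp only [Finset.coe_filter, mem_piAntidiag_sum, Set.mem_ofPred_eq]
    refine ⟨⟨?_, fun _ _ => Finset.mem_univ _⟩, ?_⟩
    · rw [← Finset.sum_add_sum_compl S]
      simp only [Pi.add_apply, Finset.sum_add_distrib]
      omega
    · simp only [Pi.add_apply, Finset.sum_add_distrib]
      omega
  · intro x _
    funext i
    by_cases h : i ∈ S <;> simp [h]
  · rintro ⟨y, z⟩ hyz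
    simp only [Finset.coe_product, Set.mem_prod, Finset.mem_coe, mem_piAntidiag_sum] at hyz
    obtain ⟨⟨-, h2⟩, -, h4⟩ := hyz
    have h5 : ∀ i, i ∉ S → y i = 0 := fun i hi => by
      by_contra h
      exact hi (h2 i h)
    have h6 : ∀ i, i ∈ S → z i = 0 := fun i hi => by
      by_contra h
      exact Finset.mem_compl.1 (h4 i h) hi
    refine Prod.ext (funext fun i => ?_) (funext fun i => ?_)
    · by_cases h : i ∈ S <;> simp [h, h5, h6]
    · by_cases h : i ∈ S <;> simp [h, h5, h6]

lemma card_filter_lt_sum {n : ℕ} (S : Finset (Fin n)) (t : ℕ) :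
    (((Finset.piAntidiag Finset.univ (2 * t)).filter
      fun x : Fin n → ℕ => t < ∑ i ∈ S, x i).card : ℤ) = excessCount S.card Sᶜ.card t := by
  rw [Finset.card_eq_sum_card_fiberwise (f := fun x => ∑ i ∈ Sᶜ, x i) (t := Finset.range t)]
  · rw [Nat.cast_sum, excessCount]
    refine Finset.sum_congr rfl fun v hv => ?_
    have hv := Finset.mem_range.1 hv
    rw [← Nat.cast_mul, ← card_filter_sum_eq, Finset.filter_filter,
      show 2 * t - v + v = 2 * t by omega]
    congr 2
    refine Finset.filter_congr fun x hx => ?_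
    have h1 := (mem_piAntidiag_sum.1 hx).1
    have h3 := Finset.sum_add_sum_compl S x
    constructor
    · exact fun h => h.2
    · exact fun h => ⟨by omega, h⟩
  · intro x hx
    simp only [Finset.coe_filter, mem_piAntidiag_sum, Set.mem_ofPred_eq] at hx
    have h3 := Finset.sum_add_sum_compl S x
    simp only [Finset.coe_range, Set.mem_Iio]
    omega

/-- The fiber of a coloring over a color. -/
def colorClass {n : ℕ} (c : Fin n → ℕ) (j : ℕ) : Finset (Fin n) :=
  Finset.univ.filter fun i => c i = j

/-- The nonnegative integer vectors of total sum `2t` whose sum over every color class is at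
most `t`. -/
noncomputable def balancedVectors {n : ℕ} (c : Fin n → ℕ) (t : ℕ) : Finset (Fin n → ℕ) :=
  (Finset.piAntidiag Finset.univ (2 * t)).filter
    fun x => ∀ j ∈ Finset.univ.image c, ∑ i ∈ colorClass c j, x i ≤ t

lemma mem_balancedVectors {n : ℕ} {c : Fin n → ℕ} {t : ℕ} {x : Fin n → ℕ} :
    x ∈ balancedVectors c t ↔ ∑ i, x i = 2 * t ∧ ∀ j, ∑ i ∈ colorClass c j, x i ≤ t := by
  simp only [balancedVectors, Finset.mem_filter, mem_piAntidiag_sum, Finset.mem_univ,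
    implies_true, and_true]
  refine and_congr_right fun _ => ⟨fun h j => ?_, fun h j _ => h j⟩
  by_cases hj : j ∈ Finset.univ.image c
  · exact h j hj
  · rw [colorClass, Finset.filter_eq_empty_iff.2]
    · simp
    · intro i _ hi
      exact hj (Finset.mem_image.2 ⟨i, Finset.mem_univ _, hi⟩)

lemma disjoint_colorClass {n : ℕ} (c : Fin n → ℕ) {j k : ℕ} (h : j ≠ k) :
    Disjoint (colorClass c j) (colorClass c k) := by
  rw [Finset.disjoint_left]
  intro i hi hi'
  simp only [colorClass, Finset.mem_filter] at hi hi'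
  exact h (hi.2.symm.trans hi'.2)

lemma card_balancedVectors {n : ℕ} (c : Fin n → ℕ) (t : ℕ) :
    ((balancedVectors c t).card : ℤ) = (n.multichoose (2 * t) : ℤ) -
      ∑ j ∈ Finset.univ.image c,
        excessCount (colorClass c j).card (colorClass c j)ᶜ.card t := by
  have h := Finset.card_filter_add_card_filter_not (s := Finset.piAntidiag Finset.univ (2 * t))
    (fun x : Fin n → ℕ => ∀ j ∈ Finset.univ.image c, ∑ i ∈ colorClass c j, x i ≤ t)
  have h2 : (Finset.piAntidiag Finset.univ (2 * t)).filter (fun x : Fin n → ℕ =>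
      ¬ ∀ j ∈ Finset.univ.image c, ∑ i ∈ colorClass c j, x i ≤ t) =
      (Finset.univ.image c).biUnion fun j => (Finset.piAntidiag Finset.univ (2 * t)).filter
        fun x : Fin n → ℕ => t < ∑ i ∈ colorClass c j, x i := by
    ext x
    simp only [Finset.mem_filter, Finset.mem_biUnion]
    push Not
    exact ⟨fun ⟨a, j, b, d⟩ => ⟨j, b, a, d⟩, fun ⟨j, b, a, d⟩ => ⟨a, j, b, d⟩⟩
  rw [h2, Finset.card_biUnion, card_piAntidiag_nat, Finset.card_fin] at h
  · rw [← h, balancedVectors]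
    simp only [← card_filter_lt_sum]
    push_cast
    ring
  · intro j _ k _ hjk
    rw [Function.onFun, Finset.disjoint_left]
    intro x hx hx'
    simp only [Finset.mem_filter, mem_piAntidiag_sum] at hx hx'
    have h3 := Finset.sum_le_univ_sum_of_nonneg (f := x)
      (s := colorClass c j ∪ colorClass c k) (fun _ => Nat.zero_le _)
    rw [Finset.sum_union (disjoint_colorClass c hjk)] at h3
    omega

/-- The convex hull of the indicator vectors of the pairs of elements with different colors. -/
def colorPolytope {n : ℕ} (c : Fin n → ℕ) : Set (Fin n → ℝ) :=
  convexHull ℝ {x | ∃ a b, c a ≠ c b ∧ x = indVec {a, b}}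

lemma indVec_pair {n : ℕ} {a b : Fin n} (hab : a ≠ b) (i : Fin n) :
    indVec {a, b} i = (if i = a then 1 else 0) + (if i = b then 1 else 0) := by
  by_cases h1 : i = a
  · subst h1
    simp [indVec, hab]
  · simp [indVec, h1]

lemma sum_indVec_pair {n : ℕ} {a b : Fin n} (hab : a ≠ b) (S : Finset (Fin n)) :
    ∑ i ∈ S, indVec {a, b} i = (if a ∈ S then 1 else 0) + (if b ∈ S then 1 else 0) := by
  simp only [indVec_pair hab, Finset.sum_add_distrib, Finset.sum_ite_eq']

lemma mem_colorClass {n : ℕ} {c : Fin n → ℕ} {i : Fin n} {j : ℕ} :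
    i ∈ colorClass c j ↔ c i = j := by
  simp [colorClass]

lemma colorPolytope_subset {n : ℕ} (c : Fin n → ℕ) :
    colorPolytope c ⊆ {y | (∀ i, 0 ≤ y i) ∧ ∑ i, y i = 2 ∧
      ∀ j, ∑ i ∈ colorClass c j, y i ≤ 1} := by
  refine convexHull_min ?_ ?_
  · rintro _ ⟨a, b, hab, rfl⟩
    have hab' : a ≠ b := fun h => hab (congrArg c h)
    refine ⟨fun i => ?_, ?_, fun j => ?_⟩
    · unfold indVec
      split_ifs <;> norm_num
    · rw [sum_indVec_pair hab']
      norm_num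
    · rw [sum_indVec_pair hab']
      simp only [mem_colorClass]
      split_ifs with h1 h2
      · exact absurd (h1.trans h2.symm) hab
      all_goals norm_num
  · rintro y ⟨hy1, hy2, hy3⟩ z ⟨hz1, hz2, hz3⟩ p q hp hq hpq
    refine ⟨fun i => ?_, ?_, fun j => ?_⟩
    · exact add_nonneg (mul_nonneg hp (hy1 i)) (mul_nonneg hq (hz1 i))
    · simp only [Pi.add_apply, Pi.smul_apply, smul_eq_mul, Finset.sum_add_distrib,
        ← Finset.mul_sum, hy2, hz2]
      linarith
    · simp only [Pi.add_apply, Pi.smul_apply, smul_eq_mul, Finset.sum_add_distrib,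
        ← Finset.mul_sum]
      have h1 := mul_le_mul_of_nonneg_left (hy3 j) hp
      have h2 := mul_le_mul_of_nonneg_left (hz3 j) hq
      linarith

lemma exists_pair_of_balanced {n : ℕ} {c : Fin n → ℕ} {t : ℕ} {x : Fin n → ℕ}
    (hx : x ∈ balancedVectors c (t + 1)) :
    ∃ a b, c a ≠ c b ∧ ∃ y ∈ balancedVectors c t,
      ∀ i, x i = y i + ((if i = a then 1 else 0) + (if i = b then 1 else 0)) := by
  obtain ⟨hsum, hle⟩ := mem_balancedVectors.1 hx
  set s : ℕ → ℕ := fun j => ∑ i ∈ colorClass c j, x i with hs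
  have hle : ∀ j, s j ≤ t + 1 := hle
  have pos_of : ∀ S : Finset (Fin n), 0 < ∑ i ∈ S, x i → ∃ i ∈ S, 0 < x i := by
    intro S hS
    by_contra! h
    have := Finset.sum_eq_zero fun i hi => Nat.le_zero.1 (h i hi)
    omega
  have two : ∀ j k, j ≠ k → s j + s k ≤ ∑ i, x i := by
    intro j k hjk
    rw [hs, ← Finset.sum_union (disjoint_colorClass c hjk)]
    exact Finset.sum_le_univ_sum_of_nonneg fun _ => Nat.zero_le _
  have three : ∀ j k l, j ≠ k → j ≠ l → k ≠ l → s j + s k + s l ≤ ∑ i, x i := by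
    intro j k l hjk hjl hkl
    rw [hs, ← Finset.sum_union (disjoint_colorClass c hjk), ← Finset.sum_union
      (Finset.disjoint_union_left.2 ⟨disjoint_colorClass c hjl, disjoint_colorClass c hkl⟩)]
    exact Finset.sum_le_univ_sum_of_nonneg fun _ => Nat.zero_le _
  obtain ⟨a, ha, hamax⟩ := Finset.exists_max_image
    (Finset.univ.filter fun i => 0 < x i) (fun i => s (c i)) (by
      obtain ⟨i, hi, hi'⟩ := pos_of Finset.univ (by omega)
      exact ⟨i, by simpa using hi'⟩)
  obtain ⟨b, hb, hbmax⟩ := Finset.exists_max_image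
    (Finset.univ.filter fun i => 0 < x i ∧ c a ≠ c i) (fun i => s (c i)) (by
      have h1 := Finset.sum_add_sum_compl (colorClass c (c a)) x
      have h2 := hle (c a)
      obtain ⟨i, hi, hi'⟩ := pos_of (colorClass c (c a))ᶜ (by
        simp only [hs] at h2
        omega)
      refine ⟨i, ?_⟩
      rw [Finset.mem_compl, mem_colorClass] at hi
      simpa using ⟨hi', Ne.symm hi⟩)
  simp only [Finset.mem_filter, Finset.mem_univ, true_and] at ha hamax hb hbmax
  obtain ⟨hb, hab⟩ := hb
  have hab' : a ≠ b := fun h => hab (congrArg c h)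
  have hxy : ∀ i, x i = (x i - ((if i = a then 1 else 0) + (if i = b then 1 else 0))) +
      ((if i = a then 1 else 0) + (if i = b then 1 else 0)) := by
    intro i
    by_cases h1 : i = a
    · subst h1
      simp only [if_true, if_neg hab']
      omega
    · by_cases h2 : i = b
      · subst h2
        simp only [if_true, if_neg h1]
        omega
      · simp [h1, h2]
  refine ⟨a, b, hab, fun i => x i - ((if i = a then 1 else 0) + (if i = b then 1 else 0)),
    ?_, hxy⟩
  have hsub : ∀ S : Finset (Fin n), ∑ i ∈ S, x i =
      ∑ i ∈ S, (x i - ((if i = a then 1 else 0) + (if i = b then 1 else 0))) +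
        ((if a ∈ S then 1 else 0) + (if b ∈ S then 1 else 0)) := by
    intro S
    conv_lhs => rw [Finset.sum_congr rfl fun i _ => hxy i]
    rw [Finset.sum_add_distrib, Finset.sum_add_distrib, Finset.sum_ite_eq', Finset.sum_ite_eq']
  rw [mem_balancedVectors]
  refine ⟨?_, fun j => ?_⟩
  · have := hsub Finset.univ
    simp only [Finset.mem_univ, if_true] at this
    omega
  · have h1 := hsub (colorClass c j)
    have h2 : s j ≤ t + 1 := hle j
    simp only [mem_colorClass] at h1
    by_cases h3 : c a = j
    · rw [if_pos h3] at h1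
      simp only [hs] at h2
      omega
    by_cases h4 : c b = j
    · rw [if_pos h4] at h1
      simp only [hs] at h2
      omega
    have h5 : s j ≤ t := by
      by_contra hlt
      obtain ⟨i, hi, hi'⟩ := pos_of (colorClass c j) (by
        simp only [hs] at hlt
        omega)
      rw [mem_colorClass] at hi
      have h6 := hamax b hb
      have h7 := hbmax i ⟨hi', by rw [hi]; exact h3⟩
      rw [hi] at h7
      have h8 := three _ _ _ hab h3 h4
      omega
    simp only [hs] at h5
    omega

lemma cast_mem_smul_colorPolytope {n : ℕ} {c : Fin n → ℕ} (hc : ∃ a b, c a ≠ c b) (t : ℕ)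
    {x : Fin n → ℕ} (hx : x ∈ balancedVectors c t) :
    (fun i => (x i : ℝ)) ∈ (t : ℝ) • colorPolytope c := by
  induction t generalizing x with
  | zero =>
    obtain ⟨a, b, hab⟩ := hc
    have hne : (colorPolytope c).Nonempty := ⟨_, subset_convexHull ℝ _ ⟨a, b, hab, rfl⟩⟩
    rw [Nat.cast_zero, Set.zero_smul_set hne, Set.mem_zero]
    funext i
    have h := (mem_balancedVectors.1 hx).1
    rw [mul_zero, Finset.sum_eq_zero_iff] at h
    simp [h i (Finset.mem_univ i)]
  | succ t ih =>
    obtain ⟨a, b, hab, y, hy, hxy⟩ := exists_pair_of_balanced hx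
    have hab' : a ≠ b := fun h => hab (congrArg c h)
    have hconv : Convex ℝ (colorPolytope c) := convex_convexHull ℝ _
    rw [Nat.cast_succ, hconv.add_smul t.cast_nonneg zero_le_one, one_smul]
    refine Set.mem_add.2 ⟨_, ih hy, _, subset_convexHull ℝ _ ⟨a, b, hab, rfl⟩, ?_⟩
    funext i
    rw [Pi.add_apply, indVec_pair hab', hxy i]
    push_cast
    rfl

lemma latticeCount_smul_colorPolytope {n : ℕ} {c : Fin n → ℕ} (hc : ∃ a b, c a ≠ c b) (t : ℕ) :
    latticeCount ((t : ℝ) • colorPolytope c) = (balancedVectors c t).card := by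
  have hinj : Function.Injective fun (x : Fin n → ℕ) (i : Fin n) => (x i : ℝ) :=
    fun x y h => funext fun i => Nat.cast_injective (congrFun h i)
  rw [latticeCount, ← Set.ncard_coe_finset, ← Set.ncard_image_of_injective _ hinj]
  congr 1
  ext y
  simp only [Set.mem_ofPred_eq, Set.mem_image, Finset.mem_coe]
  constructor
  · rintro ⟨hy, hint⟩
    obtain ⟨z, hz, rfl⟩ := Set.mem_smul_set.1 hy
    obtain ⟨h0, h2, h1⟩ := colorPolytope_subset c hz
    have ht : (0 : ℝ) ≤ t := t.cast_nonneg
    have hnat : ∀ i, ∃ m : ℕ, ((t : ℝ) • z) i = m := by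
      intro i
      obtain ⟨m, hm⟩ := hint i
      have hm0 : (0 : ℝ) ≤ (m : ℝ) := hm ▸ mul_nonneg ht (h0 i)
      obtain ⟨k, rfl⟩ := Int.eq_ofNat_of_zero_le (Int.cast_nonneg_iff.1 hm0)
      exact ⟨k, by rw [hm]; simp⟩
    choose x hx using hnat
    refine ⟨x, mem_balancedVectors.2 ⟨?_, fun j => ?_⟩, funext fun i => (hx i).symm⟩
    · have : ((∑ i, x i : ℕ) : ℝ) = ((2 * t : ℕ) : ℝ) := by
        push_cast
        simp only [← hx, Pi.smul_apply, smul_eq_mul, ← Finset.mul_sum, h2]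
        ring
      exact_mod_cast this
    · have : ((∑ i ∈ colorClass c j, x i : ℕ) : ℝ) ≤ t := by
        push_cast
        simp only [← hx, Pi.smul_apply, smul_eq_mul, ← Finset.mul_sum]
        exact mul_le_of_le_one_right ht (h1 j)
      exact_mod_cast this
  · rintro ⟨x, hx, rfl⟩
    exact ⟨cast_mem_smul_colorPolytope hc t hx, fun i => ⟨x i, by simp⟩⟩

lemma normVol_eq_fwdDiff_iter {n : ℕ} (P : Set (Fin n → ℝ)) (d : ℕ) :
    normVol P d = (fwdDiff 1)^[d] (fun t : ℕ => (latticeCount ((t : ℝ) • P) : ℤ)) 0 := by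
  rw [fwdDiff_iter_eq_sum_shift, ← Finset.sum_range_reflect, normVol]
  refine Finset.sum_congr rfl fun j hj => ?_
  have hj := Finset.mem_range.1 hj
  rw [show d + 1 - 1 - j = d - j by omega, show d - (d - j) = j by omega,
    Nat.choose_symm (by omega)]
  simp

lemma normVol_colorPolytope {m : ℕ} {c : Fin (m + 1) → ℕ} (hc : ∃ a b, c a ≠ c b) :
    normVol (colorPolytope c) m = 2 ^ m - ∑ j ∈ Finset.univ.image c,
      ∑ i ∈ Finset.range (colorClass c j).card, (m.choose i : ℤ) := by
  have h : (fun t : ℕ => (latticeCount ((t : ℝ) • colorPolytope c) : ℤ)) =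
      (fun t : ℕ => ((2 * t + m).choose m : ℤ)) - ∑ j ∈ Finset.univ.image c,
        excessCount (colorClass c j).card (colorClass c j)ᶜ.card := by
    funext t
    rw [latticeCount_smul_colorPolytope hc, card_balancedVectors, Pi.sub_apply,
      Finset.sum_apply, Nat.multichoose_eq, show m + 1 + 2 * t - 1 = 2 * t + m by omega,
      Nat.choose_symm_add]
  rw [normVol_eq_fwdDiff_iter, h, fwdDiff_iter_sub, fwdDiff_iter_choose_two_mul,
    fwdDiff_iter_finsetSum, Pi.sub_apply, Finset.sum_apply]
  congr 1
  refine Finset.sum_congr rfl fun j _ => ?_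
  obtain ⟨q, hq⟩ : ∃ q, (colorClass c j)ᶜ.card = q + 1 := by
    refine Nat.exists_eq_succ_of_ne_zero fun h0 => ?_
    obtain ⟨a, b, hab⟩ := hc
    rw [Finset.card_eq_zero, Finset.compl_eq_empty_iff] at h0
    have h1 : ∀ i, c i = j := fun i => mem_colorClass.1 (h0 ▸ Finset.mem_univ i)
    exact hab ((h1 a).trans (h1 b).symm)
  have hm := Finset.card_add_card_compl (colorClass c j)
  rw [hq, Fintype.card_fin] at hm
  have hm : m = (colorClass c j).card + q := by omega
  have := congrFun (fwdDiff_iter_excessCount (colorClass c j).card q) 0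
  rw [← hm] at this
  rw [hq, this]

/-- The coloring of the ground set by the parallel classes of `M_n[k,ℓ]`: the first `n - ℓ - 1`
elements form one class, the last `k` elements another one, and the remaining ones are
singletons. -/
def parallelClass (n k l : ℕ) (i : Fin n) : ℕ :=
  max (n - l - 2) (min i.val (n - k))

lemma pathHeight_pair {n : ℕ} {a b : Fin n} (hab : a ≠ b) (i : ℕ) :
    pathHeight {a, b} i = (if a.val < i then 1 else 0) + (if b.val < i then 1 else 0) := by
  rw [pathHeight, Finset.card_filter, Finset.sum_pair hab]

lemma mem_MklBases {n k l : ℕ} (hk : 1 ≤ k) (hkl : k ≤ l) (hl : l + 2 ≤ n)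
    {B : Finset (Fin n)} :
    B ∈ MklBases n k l ↔
      ∃ a b, parallelClass n k l a ≠ parallelClass n k l b ∧ B = {a, b} := by
  rw [MklBases, @Finset.mem_filter _ _ (_)]
  constructor
  · rintro ⟨-, hcard, hB⟩
    obtain ⟨a, b, hab, rfl⟩ := Finset.card_eq_two.1 hcard
    refine ⟨a, b, fun h => hab (Fin.ext ?_), rfl⟩
    have h1 := (hB (n - k) (Finset.mem_range.2 (by omega))).1
    have h2 := (hB (n - l - 1) (Finset.mem_range.2 (by omega))).2
    rw [pathHeight_pair hab, lowerHt] at h1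
    rw [pathHeight_pair hab, upperHt] at h2
    unfold parallelClass at h
    split_ifs at h1 <;> split_ifs at h2 <;> omega
  · rintro ⟨a, b, h, rfl⟩
    have hab : a ≠ b := fun hab => h (by rw [hab])
    refine ⟨Finset.mem_univ _, Finset.card_pair hab, fun i hi => ?_⟩
    have hi := Finset.mem_range.1 hi
    have ha := a.isLt
    have hb := b.isLt
    rw [pathHeight_pair hab, lowerHt, upperHt]
    unfold parallelClass at h
    split_ifs <;> omega

lemma MklPolytope_eq_colorPolytope {n k l : ℕ} (hk : 1 ≤ k) (hkl : k ≤ l) (hl : l + 2 ≤ n) :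
    MklPolytope n k l = colorPolytope (parallelClass n k l) := by
  rw [MklPolytope, colorPolytope]
  congr 1
  ext x
  simp only [mem_MklBases hk hkl hl, Set.mem_ofPred_eq]
  constructor
  · rintro ⟨_, ⟨a, b, h, rfl⟩, rfl⟩
    exact ⟨a, b, h, rfl⟩
  · rintro ⟨a, b, h, rfl⟩
    exact ⟨_, ⟨a, b, h, rfl⟩, rfl⟩

lemma card_filter_val_Ico {n a b : ℕ} (hb : b ≤ n) :
    (Finset.univ.filter fun i : Fin n => a ≤ i.val ∧ i.val < b).card = b - a := by
  rw [← Nat.card_Ico, ← Finset.card_map Fin.valEmbedding]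
  congr 1
  ext j
  simp only [Finset.mem_map, Finset.mem_filter, Finset.mem_univ, true_and,
    Fin.valEmbedding_apply, Finset.mem_Ico]
  constructor
  · rintro ⟨i, hi, rfl⟩
    exact hi
  · exact fun h => ⟨⟨j, by omega⟩, h, rfl⟩

lemma card_colorClass_parallelClass {n k l j : ℕ} (hk : 1 ≤ k) (hkl : k ≤ l)
    (hl : l + 2 ≤ n) (hj : n - l - 2 ≤ j) (hj' : j ≤ n - k) :
    (colorClass (parallelClass n k l) j).card =
      if j = n - l - 2 then n - l - 1 else if j = n - k then k else 1 := by
  have key : ∀ a b, b ≤ n → (∀ i : Fin n, parallelClass n k l i = j ↔ a ≤ i.val ∧ i.val < b) →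
      (colorClass (parallelClass n k l) j).card = b - a := by
    intro a b hb h
    rw [← card_filter_val_Ico hb, colorClass]
    simp only [h]
  split_ifs with h1 h2
  · rw [key 0 (n - l - 1) (by omega) fun i => by unfold parallelClass; omega]
    rfl
  · rw [key (n - k) n le_rfl fun i => by have := i.isLt; unfold parallelClass; omega]
    omega
  · rw [key j (j + 1) (by omega) fun i => by unfold parallelClass; omega]
    omega

lemma sigmaVol_eq {m k l : ℕ} (hk : 1 ≤ k) (hkl : k ≤ l) (hl : l + 1 ≤ m) :
    sigmaVol (m + 1) k l = 2 ^ m - (∑ i ∈ Finset.range (m - l), (m.choose i : ℤ) +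
      ∑ i ∈ Finset.range k, (m.choose i : ℤ) + ((l : ℤ) - k + 1)) := by
  have hl' : l + 2 ≤ m + 1 := by omega
  set c := parallelClass (m + 1) k l with hc
  have hne : ∃ a b, c a ≠ c b :=
    ⟨⟨0, by omega⟩, ⟨m, by omega⟩, by simp only [hc, parallelClass]; omega⟩
  rw [sigmaVol, if_pos ⟨hk, hkl, by omega⟩, MklPolytope_eq_colorPolytope hk hkl hl',
    Nat.add_sub_cancel, normVol_colorPolytope hne]
  congr 1
  have hsub : Finset.univ.image c ⊆ Finset.Icc (m + 1 - l - 2) (m + 1 - k) := by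
    intro j hj
    obtain ⟨i, -, rfl⟩ := Finset.mem_image.1 hj
    rw [Finset.mem_Icc, hc, parallelClass]
    omega
  rw [Finset.sum_subset hsub, ← Finset.Ioc_insert_left (by omega), Finset.sum_insert (by simp),
    ← Finset.Ioo_insert_right (by omega), Finset.sum_insert (by simp),
    card_colorClass_parallelClass hk hkl hl' le_rfl (by omega), if_pos rfl,
    card_colorClass_parallelClass hk hkl hl' (by omega) le_rfl, if_neg (by omega), if_pos rfl,
    Finset.sum_congr (s₁ := Finset.Ioo _ _) rfl (g := fun _ => (1 : ℤ))]
  · rw [Finset.sum_const, Nat.card_Ioo, show m + 1 - l - 1 = m - l by omega]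
    simp only [nsmul_eq_mul, mul_one]
    rw [show m + 1 - k - (m + 1 - l - 2) - 1 = l + 1 - k by omega, Nat.cast_sub (by omega)]
    push_cast
    ring
  · intro j hj
    rw [Finset.mem_Ioo] at hj
    rw [card_colorClass_parallelClass hk hkl hl' hj.1.le hj.2.le, if_neg hj.1.ne',
      if_neg hj.2.ne]
    simp
  · intro j _ hj
    have : (colorClass c j).card = 0 := by
      rw [Finset.card_eq_zero, colorClass, Finset.filter_eq_empty_iff]
      exact fun i _ hi => hj (Finset.mem_image.2 ⟨i, Finset.mem_univ _, hi⟩)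
    rw [this, Finset.sum_range_zero]

lemma sum_range_choose_succ (m r : ℕ) :
    ∑ i ∈ Finset.range (r + 1), ((m + 1).choose i : ℤ) =
      ∑ i ∈ Finset.range (r + 1), (m.choose i : ℤ) + ∑ i ∈ Finset.range r, (m.choose i : ℤ) := by
  rw [Finset.sum_range_succ', Finset.sum_range_succ' _ r]
  simp only [Nat.choose_succ_succ, Nat.choose_zero_right]
  push_cast
  rw [Finset.sum_add_distrib]
  ring

lemma sum_range_choose_add_sum_range_choose {m a b : ℕ} (h : a + b = m + 1) :
    ∑ i ∈ Finset.range a, (m.choose i : ℤ) + ∑ i ∈ Finset.range b, (m.choose i : ℤ) = 2 ^ m := by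
  have h1 : ∑ i ∈ Finset.range (m + 1), (m.choose i : ℤ) = 2 ^ m := by
    exact_mod_cast Nat.sum_range_choose m
  rw [← h1, ← h, Finset.sum_range_add, add_right_inj, ← Finset.sum_range_reflect]
  refine Finset.sum_congr rfl fun i hi => ?_
  have hi := Finset.mem_range.1 hi
  rw [Nat.choose_symm_of_eq_add (show m = (b - 1 - i) + (a + i) by omega)]

/-- For `n ≥ 4` and `1 ≤ k ≤ ℓ ≤ n - 2` with `ℓ ≥ 2`,
`σ_n(k, ℓ-1) + σ_n(k, ℓ) + (C(n-1, k-1) + ℓ - k) = σ_{n+1}(k, ℓ)`. -/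
theorem sigma_recursion (n k l : ℕ) (hn : 4 ≤ n) (hk : 1 ≤ k) (hkl : k ≤ l)
    (hl : l ≤ n - 2) (hl2 : 2 ≤ l) :
    sigmaVol n k (l - 1) + sigmaVol n k l +
      (((n - 1).choose (k - 1) : ℤ) + (l : ℤ) - (k : ℤ)) = sigmaVol (n + 1) k l := by
  obtain ⟨m, rfl⟩ : ∃ m, n = m + 1 := ⟨n - 1, by omega⟩
  obtain ⟨r, rfl⟩ : ∃ r, k = r + 1 := ⟨k - 1, by omega⟩
  obtain ⟨s, rfl⟩ : ∃ s, l = s + 1 := ⟨l - 1, by omega⟩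
  have hS := sum_range_choose_succ m (m - (s + 1))
  have hK := sum_range_choose_succ m r
  have hR := Finset.sum_range_succ (fun i => (m.choose i : ℤ)) r
  have hprev : sigmaVol (m + 1) (r + 1) s = 2 ^ m -
      (∑ i ∈ Finset.range (m - s), (m.choose i : ℤ) +
        ∑ i ∈ Finset.range (r + 1), (m.choose i : ℤ) + ((s : ℤ) - r)) := by
    by_cases h : r + 1 ≤ s
    · rw [sigmaVol_eq hk h (by omega)]
      push_cast
      ring
    · obtain rfl : r = s := by omega
      rw [sigmaVol, if_neg (by omega),
        sum_range_choose_add_sum_range_choose (show m - r + (r + 1) = m + 1 by omega)]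
      ring
  rw [sigmaVol_eq hk hkl (by omega), sigmaVol_eq hk hkl (by omega), Nat.add_sub_cancel,
    Nat.add_sub_cancel, Nat.add_sub_cancel, hprev,
    show m + 1 - (s + 1) = m - (s + 1) + 1 by omega, hS, hK, hR,
    show m - s = m - (s + 1) + 1 by omega]
  push_cast
  ring
end

section
/- Let S = M[U,L] be a snake on [n] with lower path L written as the 0/1-vector (L₁,…,L_n), let ℒ be a labelling of S, and let Δ(ℒ) = conv{B₁,…,B_n} ⊆ ℝⁿ be the associated simplex, where B₁ = (L₁,…,L_n) and B_{i+1} = f(B_i) is obtained by successive flips. Then the linear map π : ℝⁿ → ℝ^{n−1} defined by π(p₁,…,p_n) = (p₁−L₁, (p₁−L₁)+(p₂−L₂), …, Σ_{i=1}^{n−1}(p_i−L_i)) maps Δ(ℒ) onto the simplex of the canonical (Stanley) triangulation of the order polytope 𝒪(F) corresponding to the linear extension ℒ_F induced by ℒ, where F is the fence associated to S. -/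
/-!
Statement 14: For a snake `S = M[U,L]` on `[n]` with a labelling `ℒ`, the linear map
`π(p)_j = ∑_{i ≤ j} (p_i - L_i)` maps the simplex `Δ(ℒ) = conv{B₁, …, B_n}` (obtained
from the lower path `L` by successive flips guided by the labels of `ℒ`) onto the
simplex of Stanley's canonical triangulation of the order polytope of the fence of `S`
corresponding to the linear extension induced by `ℒ`.

A snake on `[n]` has exactly one cell on each antidiagonal; it is encoded by the
heights `y 0, …, y (n-2)` of its cells (`y 0 = 0` and each height increases by `0` or
`1`).  A labelling is encoded by the bijection `lab` assigning to each cell its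
(0-based) label; the monotonicity constraints on the labels are exactly the statement
that `lab` is a linear extension of the fence of the snake.  The vertex `B_{t+1}` of
`Δ(ℒ)` is the lattice path passing above exactly the cells with label `< t`.
-/

/-- The height, after `i` steps, of the lattice path `B_{t+1}` obtained from the lower
path of the snake by flipping the boxes with (0-based) labels `< t`.  For `t = 0` this
is the lower path `L`, and for `t = n - 1` the upper path `U`. -/
def flipHt (n : ℕ) (y lab : ℕ → ℕ) (t i : ℕ) : ℕ :=
  if i = 0 then 0
  else if i ≤ n - 1 then y (i - 1) + (if lab (i - 1) < t then 1 else 0)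
  else y (n - 2) + 1

/-- The vertex `B_{t+1}` of the simplex `Δ(ℒ)`, as a 0/1 vector in `ℝⁿ`. -/
def flipVertex (n : ℕ) (y lab : ℕ → ℕ) (t : ℕ) : Fin n → ℝ :=
  fun i => (flipHt n y lab t (i.val + 1) : ℝ) - (flipHt n y lab t i.val : ℝ)

/-- The simplex `Δ(ℒ) = conv{B₁, …, B_n}` of the alcoved triangulation of the snake
polytope associated to the labelling `lab`. -/
noncomputable def snakeSimplex (n : ℕ) (y lab : ℕ → ℕ) : Set (Fin n → ℝ) :=
  convexHull ℝ {v | ∃ t : ℕ, t < n ∧ v = flipVertex n y lab t}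

/-- Extension of a vector of `ℝⁿ` to a function on `ℕ` (by zero). -/
def extVec {n : ℕ} (p : Fin n → ℝ) (i : ℕ) : ℝ :=
  if h : i < n then p ⟨i, h⟩ else 0

/-- The projection `π : ℝⁿ → ℝ^{n-1}`,
`π(p)_j = (p_1 - L_1) + (p_2 - L_2) + ⋯ + (p_j - L_j)`, where `L` is the 0/1 vector of
the lower path of the snake. -/
def snakeProj (n : ℕ) (y lab : ℕ → ℕ) (p : Fin n → ℝ) : Fin (n - 1) → ℝ :=
  fun j => ∑ i ∈ Finset.range (j.val + 1),
    (extVec p i - ((flipHt n y lab 0 (i + 1) : ℝ) - (flipHt n y lab 0 i : ℝ)))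

/-- The simplex of Stanley's canonical triangulation of the order polytope of the
fence of the snake corresponding to the linear extension `lab`: the points of the
unit cube whose coordinates are monotone along the linear extension. -/
def fenceSimplex (n : ℕ) (lab : ℕ → ℕ) : Set (Fin (n - 1) → ℝ) :=
  {x | (∀ j, 0 ≤ x j ∧ x j ≤ 1) ∧
       ∀ j j' : Fin (n - 1), lab j.val ≤ lab j'.val → x j' ≤ x j}

theorem sum_range_sub_succ_mul_indicator (z : ℕ → ℝ) (k N : ℕ) :
    ∑ t ∈ Finset.range N, (z t - z (t + 1)) * (if k < t then 1 else 0) =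
      if k < N then z (k + 1) - z N else 0 := by
  induction N with
  | zero => simp
  | succ N ih =>
    rw [Finset.sum_range_succ, ih]
    rcases lt_trichotomy k N with h | h | h
    · rw [if_pos h, if_pos h, if_pos (by omega)]
      ring
    · subst h
      simp
    · rw [if_neg (by omega), if_neg (by omega), if_neg (by omega)]
      ring

/-- The `0/1` vector of the cells with label `< t`: a vertex of the order polytope. -/
def labelIndicator (n : ℕ) (lab : ℕ → ℕ) (t : ℕ) : Fin (n - 1) → ℝ :=
  fun j => if lab j.val < t then 1 else 0

/-- The projection `snakeProj` as an affine map. -/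
noncomputable def snakeProjAffine (n : ℕ) (y lab : ℕ → ℕ) :
    (Fin n → ℝ) →ᵃ[ℝ] (Fin (n - 1) → ℝ) :=
  (LinearMap.pi fun j : Fin (n - 1) => ∑ i ∈ Finset.range (j.val + 1),
      (if h : i < n then LinearMap.proj (R := ℝ) (φ := fun _ : Fin n => ℝ) ⟨i, h⟩
        else 0)).toAffineMap +
    AffineMap.const ℝ (Fin n → ℝ) (snakeProj n y lab 0)

theorem coe_snakeProjAffine (n : ℕ) (y lab : ℕ → ℕ) :
    ⇑(snakeProjAffine n y lab) = snakeProj n y lab := by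
  funext p j
  simp only [snakeProjAffine, snakeProj, AffineMap.coe_add, LinearMap.coe_toAffineMap,
    Pi.add_apply, LinearMap.pi_apply, LinearMap.sum_apply, AffineMap.const_apply,
    ← Finset.sum_add_distrib]
  refine Finset.sum_congr rfl fun i _ => ?_
  by_cases h : i < n <;> simp [extVec, h, sub_eq_add_neg]

theorem snakeProj_flipVertex (n : ℕ) (y lab : ℕ → ℕ) (t : ℕ) :
    snakeProj n y lab (flipVertex n y lab t) = labelIndicator n lab t := by
  funext j
  have hj := j.isLt
  have hext : ∀ i ∈ Finset.range (j.val + 1), extVec (flipVertex n y lab t) i =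
      (flipHt n y lab t (i + 1) : ℝ) - flipHt n y lab t i := by
    intro i hi
    rw [Finset.mem_range] at hi
    rw [extVec, dif_pos (by omega), flipVertex]
  have hj' : j.val + 1 ≤ n - 1 := hj
  rw [snakeProj, Finset.sum_sub_distrib, Finset.sum_congr rfl hext,
    Finset.sum_range_sub (fun i => (flipHt n y lab t i : ℝ)),
    Finset.sum_range_sub (fun i => (flipHt n y lab 0 i : ℝ))]
  simp [flipHt, labelIndicator, hj']

theorem convex_fenceSimplex (n : ℕ) (lab : ℕ → ℕ) : Convex ℝ (fenceSimplex n lab) := by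
  rintro u ⟨hu, hu'⟩ v ⟨hv, hv'⟩ a b ha hb hab
  refine ⟨fun j => ?_, fun j j' h => ?_⟩
  · simp only [Pi.add_apply, Pi.smul_apply, smul_eq_mul]
    constructor
    · exact add_nonneg (mul_nonneg ha (hu j).1) (mul_nonneg hb (hv j).1)
    · linarith [mul_le_mul_of_nonneg_left (hu j).2 ha, mul_le_mul_of_nonneg_left (hv j).2 hb]
  · simp only [Pi.add_apply, Pi.smul_apply, smul_eq_mul]
    exact add_le_add (mul_le_mul_of_nonneg_left (hu' j j' h) ha)
      (mul_le_mul_of_nonneg_left (hv' j j' h) hb)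

theorem labelIndicator_mem_fenceSimplex (n : ℕ) (lab : ℕ → ℕ) (t : ℕ) :
    labelIndicator n lab t ∈ fenceSimplex n lab := by
  refine ⟨fun j => ?_, fun j j' h => ?_⟩
  · unfold labelIndicator
    split_ifs <;> norm_num
  · unfold labelIndicator
    split_ifs
    · exact le_rfl
    · omega
    · exact zero_le_one
    · exact le_rfl

theorem fenceSimplex_subset_convexHull {n : ℕ} (hn : 2 ≤ n) {lab : ℕ → ℕ}
    (hlab : Set.BijOn lab (Set.Iio (n - 1)) (Set.Iio (n - 1))) :
    fenceSimplex n lab ⊆ convexHull ℝ {w | ∃ t : ℕ, t < n ∧ w = labelIndicator n lab t} := by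
  rintro x ⟨hx, hmono⟩
  have hsurj : ∀ k, k < n - 1 → ∃ j : Fin (n - 1), lab j.val = k := fun k hk =>
    let ⟨j, hj, hjk⟩ := hlab.surjOn hk
    ⟨⟨j, hj⟩, hjk⟩
  choose σ hσ using hsurj
  let z : ℕ → ℝ := fun t =>
    if t = 0 then 1 else if h : t - 1 < n - 1 then x (σ (t - 1) h) else 0
  have hz0 : z 0 = 1 := rfl
  have hzn : z n = 0 := by
    simp only [z]
    rw [if_neg (by omega), dif_neg (by omega)]
  have hzlab : ∀ j : Fin (n - 1), z (lab j.val + 1) = x j := by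
    intro j
    have hj : lab j.val < n - 1 := hlab.mapsTo j.isLt
    have hinv : σ (lab j.val) hj = j :=
      Fin.ext (hlab.injOn (σ _ hj).isLt j.isLt (hσ _ hj))
    simp [z, hj, hinv]
  have hanti : ∀ t, 0 ≤ z t - z (t + 1) := by
    intro t
    rw [sub_nonneg]
    by_cases h1 : t < n - 1
    · obtain ⟨j', hj'⟩ : ∃ j : Fin (n - 1), lab j.val = t := ⟨_, hσ t h1⟩
      rw [← hj', hzlab j', hj']
      rcases t with _ | s
      · exact (hx j').2
      · have hs := hσ s (by omega)
        conv_rhs => rw [← hs]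
        rw [hzlab]
        exact hmono _ _ (by omega)
    · have hz : z (t + 1) = 0 := by simp [z, h1]
      rw [hz]
      simp only [z]
      split_ifs
      · exact zero_le_one
      · exact (hx _).1
      · exact le_rfl
  have hsum : x = ∑ t ∈ Finset.range n, (z t - z (t + 1)) • labelIndicator n lab t := by
    funext j
    have hj : lab j.val < n - 1 := hlab.mapsTo j.isLt
    simp only [Finset.sum_apply, Pi.smul_apply, smul_eq_mul, labelIndicator]
    rw [sum_range_sub_succ_mul_indicator, if_pos (by omega), hzn, hzlab, sub_zero]
  rw [hsum]
  refine (convex_convexHull ℝ _).sum_mem (fun t _ => hanti t) ?_ fun t ht =>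
    subset_convexHull ℝ _ ⟨t, Finset.mem_range.mp ht, rfl⟩
  rw [Finset.sum_range_sub', hz0, hzn, sub_zero]

/-- Let `S` be a snake on `[n]` (encoded by its cell heights `y`) and
`ℒ` a labelling of `S` (encoded by the bijection `lab`, a linear extension of the fence
of `S`).  Then the projection `π` maps the simplex `Δ(ℒ)` onto the simplex of the
canonical triangulation of the order polytope of the fence of `S` corresponding to the
linear extension induced by `ℒ`. -/
theorem snake_simplex_projects_to_order_simplex (n : ℕ) (hn : 2 ≤ n)
    (y : ℕ → ℕ) (hy0 : y 0 = 0)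
    (hystep : ∀ j : ℕ, j + 1 ≤ n - 2 → (y (j + 1) = y j ∨ y (j + 1) = y j + 1))
    (lab : ℕ → ℕ) (hlab : Set.BijOn lab (Set.Iio (n - 1)) (Set.Iio (n - 1)))
    (hlabelling : ∀ j : ℕ, j + 1 ≤ n - 2 →
      ((y (j + 1) = y j + 1 → lab j < lab (j + 1)) ∧
       (y (j + 1) = y j → lab (j + 1) < lab j))) :
    snakeProj n y lab '' snakeSimplex n y lab = fenceSimplex n lab := by
  have himage : snakeProj n y lab '' {v | ∃ t : ℕ, t < n ∧ v = flipVertex n y lab t} =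
      {w | ∃ t : ℕ, t < n ∧ w = labelIndicator n lab t} := by
    ext w
    constructor
    · rintro ⟨_, ⟨t, ht, rfl⟩, rfl⟩
      exact ⟨t, ht, snakeProj_flipVertex n y lab t⟩
    · rintro ⟨t, ht, rfl⟩
      exact ⟨_, ⟨t, ht, rfl⟩, snakeProj_flipVertex n y lab t⟩
  rw [snakeSimplex, ← coe_snakeProjAffine, AffineMap.image_convexHull, coe_snakeProjAffine,
    himage]
  refine (convexHull_min ?_ (convex_fenceSimplex n lab)).antisymm
    (fenceSimplex_subset_convexHull hn hlab)
  rintro _ ⟨t, _, rfl⟩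
  exact labelIndicator_mem_fenceSimplex n lab t
end
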